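/- Assume θ̇ has compact support and the tube is twisted. Then there exists ε₀ > 0 such that for every ε ∈ (0,ε₀) and every ψ ∈ C_c^∞(Ω₀): Q_θ[ψ] − ε ∫_{Ω₀} v(x)|ψ(x)|² dx ≥ E₁ ∫_{Ω₀} |ψ(x)|² dx. In other words, the infimum of the spectrum of the Dirichlet Laplacian in the twisted tube perturbed by the small attractive potential −εV does not drop below E₁. -/

import Mathlib

open MeasureTheory Real Set Filter

noncomputable section

/-- First partial derivative ∂₁ of a function on ℝ³ = ℝ × ℝ × ℝ. -/
def pd1 {E : Type*} [NormedAddCommGroup E] [NormedSpace ℝ E]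
    (ψ : ℝ × ℝ × ℝ → E) (x : ℝ × ℝ × ℝ) : E :=
  deriv (fun t => ψ (t, x.2.1, x.2.2)) x.1

/-- Second partial derivative ∂₂. -/
def pd2 {E : Type*} [NormedAddCommGroup E] [NormedSpace ℝ E]
    (ψ : ℝ × ℝ × ℝ → E) (x : ℝ × ℝ × ℝ) : E :=
  deriv (fun t => ψ (x.1, t, x.2.2)) x.2.1

/-- Third partial derivative ∂₃. -/
def pd3 {E : Type*} [NormedAddCommGroup E] [NormedSpace ℝ E]
    (ψ : ℝ × ℝ × ℝ → E) (x : ℝ × ℝ × ℝ) : E :=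
  deriv (fun t => ψ (x.1, x.2.1, t)) x.2.2

/-- Transverse angular derivative ∂_τ = x₃∂₂ − x₂∂₃. -/
def pdtau {E : Type*} [NormedAddCommGroup E] [NormedSpace ℝ E]
    (ψ : ℝ × ℝ × ℝ → E) (x : ℝ × ℝ × ℝ) : E :=
  x.2.2 • pd2 ψ x - x.2.1 • pd3 ψ x

/-- The straight tube Ω₀ = ℝ × ω. -/
def Omega0 (ω : Set (ℝ × ℝ)) : Set (ℝ × ℝ × ℝ) := {x | x.2 ∈ ω}

/-- Smooth compactly supported test functions with support in Ω (i.e. C_c^∞(Ω)). -/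
def IsTest3 {E : Type*} [NormedAddCommGroup E] [NormedSpace ℝ E]
    (Ω : Set (ℝ × ℝ × ℝ)) (ψ : ℝ × ℝ × ℝ → E) : Prop :=
  ContDiff ℝ (⊤ : ℕ∞) ψ ∧ HasCompactSupport ψ ∧ tsupport ψ ⊆ Ω

/-- Partial derivatives on ℝ². -/
def pd1' (f : ℝ × ℝ → ℂ) (p : ℝ × ℝ) : ℂ := deriv (fun t => f (t, p.2)) p.1

def pd2' (f : ℝ × ℝ → ℂ) (p : ℝ × ℝ) : ℂ := deriv (fun t => f (p.1, t)) p.2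

/-- Smooth compactly supported test functions on the cross-section, C_c^∞(ω). -/
def IsTest2 (ω : Set (ℝ × ℝ)) (f : ℝ × ℝ → ℂ) : Prop :=
  ContDiff ℝ (⊤ : ℕ∞) f ∧ HasCompactSupport f ∧ tsupport f ⊆ ω

/-- The lowest Dirichlet eigenvalue E₁ of −Δ on ω, defined variationally. -/
def E1 (ω : Set (ℝ × ℝ)) : ℝ :=
  sInf { r : ℝ | ∃ f : ℝ × ℝ → ℂ, IsTest2 ω f ∧ f ≠ 0 ∧
    r = (∫ p in ω, (‖pd1' f p‖ ^ 2 + ‖pd2' f p‖ ^ 2)) / ∫ p in ω, ‖f p‖ ^ 2 }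

/-- The twisted quadratic form Q_θ[ψ] = ∫_{Ω₀} (|∂₁ψ − θ̇ ∂_τψ|² + |∇'ψ|²). -/
def Qform (θ : ℝ → ℝ) (ω : Set (ℝ × ℝ)) (ψ : ℝ × ℝ × ℝ → ℂ) : ℝ :=
  ∫ x in Omega0 ω,
    (‖pd1 ψ x - deriv θ x.1 • pdtau ψ x‖ ^ 2 + ‖pd2 ψ x‖ ^ 2 + ‖pd3 ψ x‖ ^ 2)

/-- Rotation of the plane by angle ϑ about the origin. -/
def rot (ϑ : ℝ) (p : ℝ × ℝ) : ℝ × ℝ :=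
  (p.1 * Real.cos ϑ + p.2 * Real.sin ϑ, -p.1 * Real.sin ϑ + p.2 * Real.cos ϑ)

/-- The tube is twisted: θ is not constant and ω is not rotationally symmetric about
the origin (in the strong sense: some rotated copy of ω differs from ω on a set of
positive Lebesgue measure). -/
def Twisted (θ : ℝ → ℝ) (ω : Set (ℝ × ℝ)) : Prop :=
  (∃ s t : ℝ, θ s ≠ θ t) ∧
  (∃ ϑ ∈ Set.Ioo (0 : ℝ) (2 * Real.pi), volume (symmDiff (rot ϑ '' ω) ω) ≠ 0)

/-- The tube is untwisted: θ is constant or ω is invariant under every rotation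
about the origin. -/
def Untwisted (θ : ℝ → ℝ) (ω : Set (ℝ × ℝ)) : Prop :=
  (∀ s t : ℝ, θ s = θ t) ∨ (∀ ϑ : ℝ, rot ϑ '' ω = ω)


/-- Squared Euclidean length of the gradient of a real function on the plane. -/
def gradSq (g : ℝ × ℝ → ℝ) (p : ℝ × ℝ) : ℝ :=
  (fderiv ℝ g p (1, 0)) ^ 2 + (fderiv ℝ g p (0, 1)) ^ 2

/-- Real-valued smooth functions with compact support in `ω`. -/
structure IsRealTest (ω : Set (ℝ × ℝ)) (g : ℝ × ℝ → ℝ) : Prop where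
  smooth : ContDiff ℝ (⊤ : ℕ∞) g
  compact : HasCompactSupport g
  subset : tsupport g ⊆ ω

lemma gradSq_nonneg (g : ℝ × ℝ → ℝ) (p : ℝ × ℝ) : 0 ≤ gradSq g p := by
  unfold gradSq; positivity

namespace IsRealTest

variable {ω : Set (ℝ × ℝ)} {g : ℝ × ℝ → ℝ}

lemma differentiable (hg : IsRealTest ω g) : Differentiable ℝ g :=
  hg.smooth.differentiable (by simp)

lemma continuous_fderiv (hg : IsRealTest ω g) : Continuous (fderiv ℝ g) :=
  hg.smooth.continuous_fderiv (by simp)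

lemma continuous_gradSq (hg : IsRealTest ω g) : Continuous (gradSq g) := by
  have := hg.continuous_fderiv
  unfold gradSq
  fun_prop

lemma integrable_gradSq (hg : IsRealTest ω g) : Integrable (gradSq g) := by
  refine hg.continuous_gradSq.integrable_of_hasCompactSupport ?_
  refine (hg.compact.fderiv (𝕜 := ℝ)).mono fun p hp => ?_
  contrapose! hp
  simp only [Function.mem_support, not_not] at hp ⊢
  simp [gradSq, hp]

lemma integrable_pow (hg : IsRealTest ω g) {n : ℕ} (hn : n ≠ 0) :
    Integrable (fun p => g p ^ n) := by
  refine (hg.smooth.continuous.pow n).integrable_of_hasCompactSupport ?_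
  refine hg.compact.mono fun p hp => ?_
  contrapose! hp
  simp only [Function.mem_support, not_not] at hp ⊢
  simp [hp, hn]

lemma const_mul (hg : IsRealTest ω g) (c : ℝ) : IsRealTest ω (fun p => c * g p) where
  smooth := contDiff_const.mul hg.smooth
  compact := hg.compact.mul_left (f := fun _ => c)
  subset := (tsupport_mul_subset_right (f := fun _ => c) (g := g)).trans hg.subset

lemma integrable_mul_div (hg : IsRealTest ω g) {η : ℝ × ℝ → ℝ} (hη : IsRealTest ω η)
    (hg0 : ∀ p, 0 ≤ g p) {δ : ℝ} (hδ : 0 < δ) :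
    Integrable (fun p => η p ^ 2 * (gradSq g p / (g p + δ) ^ 2)) := by
  have h0 : ∀ p, g p + δ ≠ 0 := fun p => by have := hg0 p; positivity
  refine Continuous.integrable_of_hasCompactSupport ?_ ?_
  · have := hg.continuous_gradSq
    have := hg.smooth.continuous
    have := hη.smooth.continuous
    exact (by fun_prop : Continuous fun p => η p ^ 2).mul
      (hg.continuous_gradSq.div (by fun_prop) (fun p => pow_ne_zero 2 (h0 p)))
  · refine hη.compact.mono fun p hp => ?_
    contrapose! hp
    simp only [Function.mem_support, not_not] at hp ⊢
    simp [hp]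

end IsRealTest

lemma sq_add_log_variation_le {p e η u δ lam : ℝ} (hη : η ^ 2 ≤ 1) (hδ : 0 < δ) (hu : δ ≤ u)
    (hlam : 0 ≤ lam) :
    (p + lam * (2 * η * e / u - η ^ 2 * p / u ^ 2)) ^ 2
      ≤ p ^ 2 + 4 * lam * e ^ 2 + lam ^ 2 * (8 / δ ^ 2 * e ^ 2 + 2 / δ ^ 4 * p ^ 2)
        - lam * (η ^ 2 * (p ^ 2 / u ^ 2)) := by
  have hu0 : 0 < u := hδ.trans_le hu
  set X := 2 * η * e / u - η ^ 2 * p / u ^ 2 with hX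
  have hcross : 2 * (p * X) ≤ 4 * e ^ 2 - η ^ 2 * (p ^ 2 / u ^ 2) := by
    have : 2 * (p * X) = 4 * e ^ 2 - η ^ 2 * (p ^ 2 / u ^ 2) - (2 * e - η * (p / u)) ^ 2 := by
      rw [hX]; field_simp; ring
    rw [this]
    linarith [sq_nonneg (2 * e - η * (p / u))]
  have hsq : X ^ 2 ≤ 8 / δ ^ 2 * e ^ 2 + 2 / δ ^ 4 * p ^ 2 := by
    have h1 : X ^ 2 ≤ 8 * η ^ 2 * e ^ 2 / u ^ 2 + 2 * (η ^ 2) ^ 2 * p ^ 2 / u ^ 4 := by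
      have : 8 * η ^ 2 * e ^ 2 / u ^ 2 + 2 * (η ^ 2) ^ 2 * p ^ 2 / u ^ 4 - X ^ 2
          = (2 * η * e / u + η ^ 2 * p / u ^ 2) ^ 2 := by
        rw [hX]; field_simp; ring
      linarith [sq_nonneg (2 * η * e / u + η ^ 2 * p / u ^ 2)]
    have h2 : 8 * η ^ 2 * e ^ 2 / u ^ 2 ≤ 8 * 1 * e ^ 2 / δ ^ 2 := by gcongr
    have h3 : 2 * (η ^ 2) ^ 2 * p ^ 2 / u ^ 4 ≤ 2 * 1 ^ 2 * p ^ 2 / δ ^ 4 := by gcongr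
    calc X ^ 2 ≤ _ := h1.trans (add_le_add h2 h3)
      _ = _ := by ring
  nlinarith [mul_le_mul_of_nonneg_left hcross hlam,
    mul_le_mul_of_nonneg_left hsq (sq_nonneg lam)]

lemma integral_log_gradient_le {ω : Set (ℝ × ℝ)} {E : ℝ} (hE : 0 ≤ E)
    (hk : ∀ f, IsRealTest ω f → E * ∫ p, f p ^ 2 ≤ ∫ p, gradSq f p)
    {g η : ℝ × ℝ → ℝ} (hg : IsRealTest ω g) (hg0 : ∀ p, 0 ≤ g p) (hη : IsRealTest ω η)
    (hη1 : ∀ p, η p ^ 2 ≤ 1) {δ lam : ℝ} (hδ : 0 < δ) (hlam : 0 < lam) :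
    lam * ∫ p, η p ^ 2 * (gradSq g p / (g p + δ) ^ 2)
      ≤ ((∫ p, gradSq g p) - E * ∫ p, g p ^ 2) + 4 * lam * (∫ p, gradSq η p)
        + lam ^ 2 * (8 / δ ^ 2 * (∫ p, gradSq η p) + 2 / δ ^ 4 * ∫ p, gradSq g p) := by
  have h0 : ∀ p, g p + δ ≠ 0 := fun p => by have := hg0 p; positivity
  set f : ℝ × ℝ → ℝ := fun p => g p + lam * (η p ^ 2 / (g p + δ)) with hf
  have hft : IsRealTest ω f := by
    have hsub : Function.support f ⊆ tsupport g ∪ tsupport η := by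
      intro p hp
      by_contra hcon
      simp only [mem_union, not_or] at hcon
      apply hp
      simp [hf, image_eq_zero_of_notMem_tsupport hcon.1, image_eq_zero_of_notMem_tsupport hcon.2]
    have hcl : IsClosed (tsupport g ∪ tsupport η) :=
      (isClosed_tsupport g).union (isClosed_tsupport η)
    have hsub' := closure_minimal hsub hcl
    refine ⟨?_, ?_, hsub'.trans (union_subset hg.subset hη.subset)⟩
    · exact hg.smooth.add (contDiff_const.mul
        ((hη.smooth.pow 2).div (hg.smooth.add contDiff_const) h0))
    · exact (IsCompact.union hg.compact hη.compact).of_isClosed_subset (isClosed_tsupport f) hsub'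
  have hder : ∀ p w, fderiv ℝ f p w = fderiv ℝ g p w
      + lam * (2 * η p * fderiv ℝ η p w / (g p + δ) - η p ^ 2 * fderiv ℝ g p w / (g p + δ) ^ 2) := by
    intro p w
    have hgd := (hg.differentiable p).hasFDerivAt
    have hηd := (hη.differentiable p).hasFDerivAt
    have h1 := hgd.add (((hηd.pow 2).mul
      ((hasDerivAt_inv (h0 p)).comp_hasFDerivAt p (hgd.add_const δ))).const_mul lam)
    have h2 : HasFDerivAt f _ p := h1
    rw [h2.fderiv]
    have := h0 p
    simp
    field_simp
    ring
  have hpt : ∀ p, gradSq f p - E * f p ^ 2 ≤ gradSq g p - E * g p ^ 2 + 4 * lam * gradSq η p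
      + lam ^ 2 * (8 / δ ^ 2 * gradSq η p + 2 / δ ^ 4 * gradSq g p)
      - lam * (η p ^ 2 * (gradSq g p / (g p + δ) ^ 2)) := by
    intro p
    have hu : δ ≤ g p + δ := by linarith [hg0 p]
    have h1 := sq_add_log_variation_le (p := fderiv ℝ g p (1, 0)) (e := fderiv ℝ η p (1, 0))
      (hη1 p) hδ hu hlam.le
    have h2 := sq_add_log_variation_le (p := fderiv ℝ g p (0, 1)) (e := fderiv ℝ η p (0, 1))
      (hη1 p) hδ hu hlam.le
    have h3 : g p ^ 2 ≤ f p ^ 2 := by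
      have : 0 ≤ η p ^ 2 / (g p + δ) := by have := hg0 p; positivity
      have := hg0 p
      apply pow_le_pow_left₀ this
      simp only [hf]
      nlinarith
    have h4 := mul_le_mul_of_nonneg_left h3 hE
    have h5 : gradSq f p ≤ gradSq g p + 4 * lam * gradSq η p
      + lam ^ 2 * (8 / δ ^ 2 * gradSq η p + 2 / δ ^ 4 * gradSq g p)
      - lam * (η p ^ 2 * (gradSq g p / (g p + δ) ^ 2)) := by
      simp only [gradSq, hder, add_div]
      nlinarith [h1, h2]
    linarith
  have hi1 := hg.integrable_gradSq
  have hi2 := hη.integrable_gradSq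
  have hi3 := hg.integrable_pow (n := 2) (by norm_num)
  have hi4 := hg.integrable_mul_div hη hg0 hδ
  have hi5 := hft.integrable_gradSq
  have hi6 := hft.integrable_pow (n := 2) (by norm_num)
  have hle := integral_mono (hi5.sub (hi6.const_mul E))
    ((((hi1.sub (hi3.const_mul E)).add (hi2.const_mul (4 * lam))).add
      (((hi2.const_mul (8 / δ ^ 2)).add (hi1.const_mul (2 / δ ^ 4))).const_mul (lam ^ 2))).sub
      (hi4.const_mul lam)) hpt
  simp only [Pi.add_apply, Pi.sub_apply] at hle
  rw [integral_sub hi5 (hi6.const_mul E), integral_sub (by fun_prop) (by fun_prop),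
    integral_add (by fun_prop) (by fun_prop), integral_add (by fun_prop) (by fun_prop),
    integral_sub (by fun_prop) (by fun_prop)] at hle
  simp only [integral_const_mul] at hle
  rw [integral_add (by fun_prop) (by fun_prop)] at hle
  simp only [integral_const_mul] at hle
  have := hk f hft
  linarith

/-- A Gagliardo-Nirenberg-Sobolev bound for the fourth power of a plane test function. -/
lemma exists_integral_pow_four_le : ∃ C : ℝ, 0 ≤ C ∧ ∀ (ω : Set (ℝ × ℝ)) (g : ℝ × ℝ → ℝ),
    IsRealTest ω g → ∫ p, g p ^ 4 ≤ C * (2 * (∫ p, g p ^ 2) + ∫ p, gradSq g p) ^ 2 := by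
  refine ⟨lintegralPowLePowLIntegralFDerivConst (volume : Measure (ℝ × ℝ)) 2, by positivity,
    fun ω g hg => ?_⟩
  have hp : Real.HolderConjugate (Module.finrank ℝ (ℝ × ℝ)) 2 := by
    rw [Module.finrank_prod, Module.finrank_self]
    constructor <;> norm_num
  have hc : HasCompactSupport (fun p => g p ^ 2) :=
    hg.compact.comp_left (g := fun t : ℝ => t ^ 2) (by simp)
  have h := lintegral_pow_le_pow_lintegral_fderiv (volume : Measure (ℝ × ℝ))
    (u := fun p => g p ^ 2) ((hg.smooth.pow 2).of_le (by simp)) hc hp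
  have hb : ∀ p, ‖fderiv ℝ (fun p => g p ^ 2) p‖ ≤ 2 * g p ^ 2 + gradSq g p := by
    intro p
    rw [((hg.differentiable p).hasFDerivAt.pow 2).fderiv]
    have hn : ‖fderiv ℝ g p‖ ≤ |fderiv ℝ g p (1, 0)| + |fderiv ℝ g p (0, 1)| := by
      refine ContinuousLinearMap.opNorm_le_bound _ (by positivity) fun w => ?_
      have hw : w = w.1 • (1, 0) + w.2 • ((0 : ℝ), (1 : ℝ)) := by ext <;> simp
      have h1 : |w.1| ≤ ‖w‖ := norm_fst_le w
      have h2 : |w.2| ≤ ‖w‖ := norm_snd_le w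
      conv_lhs => rw [hw]
      rw [map_add, map_smul, map_smul, Real.norm_eq_abs]
      refine (abs_add_le _ _).trans ?_
      simp only [smul_eq_mul, abs_mul]
      nlinarith [abs_nonneg (fderiv ℝ g p (1, 0)), abs_nonneg (fderiv ℝ g p (0, 1))]
    simp only [norm_smul, Nat.cast_ofNat, Nat.add_one_sub_one, pow_one, nsmul_eq_mul, norm_mul,
      Real.norm_eq_abs, abs_two]
    have := mul_le_mul_of_nonneg_left hn (by positivity : 0 ≤ 2 * |g p|)
    refine this.trans ?_
    unfold gradSq
    nlinarith [sq_nonneg (|g p| - |fderiv ℝ g p (1, 0)|), sq_nonneg (|g p| - |fderiv ℝ g p (0, 1)|),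
      sq_abs (g p), sq_abs (fderiv ℝ g p (1, 0)), sq_abs (fderiv ℝ g p (0, 1))]
  have hi2 := hg.integrable_pow (n := 2) (by norm_num)
  have hi4 := hg.integrable_pow (n := 4) (by norm_num)
  have hgr := hg.integrable_gradSq
  have hR : ∫⁻ p, ‖fderiv ℝ (fun p => g p ^ 2) p‖ₑ
      ≤ ENNReal.ofReal (2 * (∫ p, g p ^ 2) + ∫ p, gradSq g p) := by
    have hnn : ∀ p, 0 ≤ 2 * g p ^ 2 + gradSq g p := fun p => by
      have := gradSq_nonneg g p
      positivity
    rw [← integral_const_mul, ← integral_add (hi2.const_mul 2) hgr,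
      ofReal_integral_eq_lintegral_ofReal (by fun_prop) (ae_of_all _ hnn)]
    refine lintegral_mono fun p => ?_
    rw [← ofReal_norm]
    exact ENNReal.ofReal_le_ofReal (hb p)
  have hL : ENNReal.ofReal (∫ p, g p ^ 4) = ∫⁻ p, ‖g p ^ 2‖ₑ ^ (2 : ℝ) := by
    rw [ofReal_integral_eq_lintegral_ofReal hi4 (ae_of_all _ fun p => by positivity)]
    refine lintegral_congr fun p => ?_
    rw [← ofReal_norm, ENNReal.ofReal_rpow_of_nonneg (by positivity) (by positivity)]
    congr 1
    rw [Real.norm_of_nonneg (by positivity)]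
    norm_cast
    ring
  have hG0 : 0 ≤ 2 * (∫ p, g p ^ 2) + ∫ p, gradSq g p := by
    have h1 : 0 ≤ ∫ p, g p ^ 2 := integral_nonneg fun p => by positivity
    have h2 : 0 ≤ ∫ p, gradSq g p := integral_nonneg fun p => gradSq_nonneg g p
    positivity
  rw [← hL] at h
  have h' := h.trans (mul_le_mul_right (ENNReal.rpow_le_rpow hR (by norm_num : (0 : ℝ) ≤ 2)) _)
  rw [ENNReal.ofReal_rpow_of_nonneg hG0 (by norm_num), ← ENNReal.ofReal_coe_nnreal,
    ← ENNReal.ofReal_mul (by positivity), ENNReal.ofReal_le_ofReal_iff (by positivity)] at h'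
  exact_mod_cast h'

lemma abs_sub_le_integral_abs_deriv {f f' : ℝ → ℝ} (hf : ∀ t, HasDerivAt f (f' t) t)
    (hf' : Continuous f') {a b s t : ℝ} (hs : s ∈ Icc a b) (ht : t ∈ Icc a b) :
    f s - f t ≤ ∫ x in Icc a b, |f' x| := by
  have h := intervalIntegral.integral_eq_sub_of_hasDerivAt (a := t) (b := s) (fun x _ => hf x)
    (hf'.intervalIntegrable _ _)
  rw [← h]
  refine (le_abs_self _).trans ((intervalIntegral.norm_integral_le_integral_norm_uIoc (f := f')).trans ?_)
  refine setIntegral_mono_set (hf'.abs.integrableOn_Icc) (ae_of_all _ fun x => abs_nonneg _) ?_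
  exact (Set.uIoc_subset_uIcc.trans (Set.uIcc_subset_Icc ht hs)).eventuallyLE

/-- An `L¹` Poincaré inequality on a square, with the mean taken over a subset. -/
lemma measure_mul_setIntegral_le {l : ℝ × ℝ → ℝ} (hl : ContDiff ℝ 1 l) (c : ℝ × ℝ) {r : ℝ}
    (hr : 0 ≤ r) {S : Set (ℝ × ℝ)} (hS : MeasurableSet S) (hSB : S ⊆ Metric.closedBall c r) :
    volume.real S * ∫ p in Metric.closedBall c r, l p
      ≤ volume.real (Metric.closedBall c r) * (∫ p in S, l p)
        + volume.real (Metric.closedBall c r) * (2 * r) *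
          ((∫ p in Metric.closedBall c r, |fderiv ℝ l p (1, 0)|)
            + ∫ p in Metric.closedBall c r, |fderiv ℝ l p (0, 1)|) := by
  have hB : Metric.closedBall c r = Icc (c.1 - r) (c.1 + r) ×ˢ Icc (c.2 - r) (c.2 + r) := by
    rw [← Real.closedBall_eq_Icc, ← Real.closedBall_eq_Icc, closedBall_prod_same]
  set I := Icc (c.1 - r) (c.1 + r) with hI
  set J := Icc (c.2 - r) (c.2 + r) with hJ
  set B := Metric.closedBall c r with hBdef
  have hBc : IsCompact B := isCompact_closedBall c r
  have hBm : MeasurableSet B := hBc.measurableSet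
  have hcd := hl.continuous_fderiv (by simp)
  have hc1 : Continuous fun p => |fderiv ℝ l p (1, 0)| := by fun_prop
  have hc2 : Continuous fun p => |fderiv ℝ l p (0, 1)| := by fun_prop
  have hIv : volume.real I = 2 * r := by
    rw [hI, Real.volume_real_Icc_of_le (by linarith)]; ring
  have hJv : volume.real J = 2 * r := by
    rw [hJ, Real.volume_real_Icc_of_le (by linarith)]; ring
  set a : ℝ → ℝ := fun y => ∫ x in I, |fderiv ℝ l (x, y) (1, 0)| with ha
  set b : ℝ → ℝ := fun x => ∫ y in J, |fderiv ℝ l (x, y) (0, 1)| with hb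
  have hac : Continuous a :=
    continuous_parametric_integral_of_continuous (f := fun y x => |fderiv ℝ l (x, y) (1, 0)|)
      (hc1.comp continuous_swap) isCompact_Icc
  have hbc : Continuous b :=
    continuous_parametric_integral_of_continuous (f := fun x y => |fderiv ℝ l (x, y) (0, 1)|)
      hc2 isCompact_Icc
  have hpt : ∀ p ∈ B, ∀ q ∈ B, l p ≤ l q + a p.2 + b q.1 := by
    intro p hp q hq
    rw [hB] at hp hq
    have h1 := abs_sub_le_integral_abs_deriv (f := fun t => l (t, p.2))
      (f' := fun t => fderiv ℝ l (t, p.2) (1, 0)) (fun t => by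
        have := (hl.differentiable (by simp) (t, p.2)).hasFDerivAt.comp_hasDerivAt t
          ((hasDerivAt_id t).prodMk (hasDerivAt_const t p.2))
        exact this) (by fun_prop) hp.1 hq.1
    have h2 := abs_sub_le_integral_abs_deriv (f := fun t => l (q.1, t))
      (f' := fun t => fderiv ℝ l (q.1, t) (0, 1)) (fun t => by
        have := (hl.differentiable (by simp) (q.1, t)).hasFDerivAt.comp_hasDerivAt t
          ((hasDerivAt_const t q.1).prodMk (hasDerivAt_id t))
        exact this) (by fun_prop) hp.2 hq.2
    simp only [ha, hb]
    simp only [Prod.mk.eta] at h1 h2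
    linarith
  have hlB : IntegrableOn l B := hl.continuous.continuousOn.integrableOn_compact hBc
  have hbB : IntegrableOn (fun q : ℝ × ℝ => b q.1) B :=
    (by fun_prop : Continuous fun q : ℝ × ℝ => b q.1).continuousOn.integrableOn_compact hBc
  have haB : IntegrableOn (fun q : ℝ × ℝ => a q.2) B :=
    (by fun_prop : Continuous fun q : ℝ × ℝ => a q.2).continuousOn.integrableOn_compact hBc
  have hBfin : volume B ≠ ⊤ := hBc.measure_ne_top
  have hSfin : volume S ≠ ⊤ := ((measure_mono hSB).trans_lt hBc.measure_lt_top).ne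
  have ib : ∫ q in B, b q.1 = 2 * r * ∫ p in B, |fderiv ℝ l p (0, 1)| := by
    rw [hB] at hbB ⊢
    rw [Measure.volume_eq_prod] at hbB ⊢
    rw [setIntegral_prod _ hbB, setIntegral_prod _ (hc2.continuousOn.integrableOn_compact
      (isCompact_Icc.prod isCompact_Icc))]
    simp only [setIntegral_const, hJv, smul_eq_mul, integral_const_mul, hb]
    rfl
  have ia : ∫ q in B, a q.2 = 2 * r * ∫ p in B, |fderiv ℝ l p (1, 0)| := by
    rw [hB] at haB ⊢
    rw [Measure.volume_eq_prod] at haB ⊢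
    have h1 : IntegrableOn (fun p => |fderiv ℝ l p (1, 0)|) (I ×ˢ J) :=
      hc1.continuousOn.integrableOn_compact (isCompact_Icc.prod isCompact_Icc)
    rw [Measure.volume_eq_prod] at h1
    rw [setIntegral_prod _ haB, setIntegral_prod _ h1]
    dsimp only
    rw [setIntegral_const, hIv, smul_eq_mul, integral_integral_swap]
    rw [IntegrableOn, ← Measure.prod_restrict] at h1
    exact h1.swap
  have hS1 : ∀ p ∈ B, volume.real S * l p
      ≤ (∫ q in S, l q) + volume.real S * a p.2 + ∫ q in B, b q.1 := by
    intro p hp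
    have hcS : ∀ t : ℝ, IntegrableOn (fun _ => t) S := fun t => integrableOn_const hSfin
    have hl' := (hlB.mono_set hSB).fun_add (hcS (a p.2))
    have h1 : ∫ q in S, l p ≤ ∫ q in S, (l q + a p.2 + b q.1) :=
      setIntegral_mono_on (hcS _) (hl'.fun_add (hbB.mono_set hSB)) hS
        (fun q hq => hpt p hp q (hSB hq))
    rw [integral_add hl' (hbB.mono_set hSB), integral_add (hlB.mono_set hSB) (hcS _)] at h1
    simp only [setIntegral_const, smul_eq_mul] at h1
    have h2 : ∫ q in S, b q.1 ≤ ∫ q in B, b q.1 := by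
      refine setIntegral_mono_set hbB (ae_of_all _ fun q => ?_) hSB.eventuallyLE
      exact integral_nonneg fun y => abs_nonneg _
    linarith
  have hcB : ∀ t : ℝ, IntegrableOn (fun _ => t) B := fun t => integrableOn_const hBfin
  have hfin := setIntegral_mono_on (hlB.const_mul (volume.real S))
    (((hcB _).fun_add (haB.const_mul (volume.real S))).fun_add (hcB _)) hBm hS1
  rw [integral_add ((hcB _).fun_add (haB.const_mul (volume.real S))) (hcB _),
    integral_add (hcB _) (haB.const_mul (volume.real S))] at hfin
  simp only [setIntegral_const, smul_eq_mul, integral_const_mul, ia, ib] at hfin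
  have hSle : volume.real S ≤ volume.real B := measureReal_mono hSB hBfin
  have hn : 0 ≤ ∫ p in B, |fderiv ℝ l p (1, 0)| := integral_nonneg fun _ => abs_nonneg _
  have := mul_le_mul_of_nonneg_right hSle (by positivity : 0 ≤ 2 * r * ∫ p in B, |fderiv ℝ l p (1, 0)|)
  linarith

/-- A normalised sequence of nonnegative test functions whose Dirichlet energy tends to `E`. -/
structure IsMinimizing (ω : Set (ℝ × ℝ)) (E : ℝ) (g : ℕ → ℝ × ℝ → ℝ) : Prop where
  test : ∀ n, IsRealTest ω (g n)
  nonneg : ∀ n p, 0 ≤ g n p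
  norm_eq : ∀ n, ∫ p, g n p ^ 2 = 1
  energy : Tendsto (fun n => (∫ p, gradSq (g n) p) - E) atTop (nhds 0)

/-- The sequence `g` tends to zero in `L²(S)`. -/
def VanishesOn (g : ℕ → ℝ × ℝ → ℝ) (S : Set (ℝ × ℝ)) : Prop :=
  Tendsto (fun n => ∫ p in S, g n p ^ 2) atTop (nhds 0)

lemma exists_eventually_integral_log_le {ω : Set (ℝ × ℝ)} {E : ℝ} (hE : 0 ≤ E)
    (hk : ∀ f, IsRealTest ω f → E * ∫ p, f p ^ 2 ≤ ∫ p, gradSq f p)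
    {g : ℕ → ℝ × ℝ → ℝ} (hg : IsMinimizing ω E g) {c : ℝ × ℝ} {r : ℝ} (hr : 0 < r)
    (hc : Metric.closedBall c (2 * r) ⊆ ω) {S : Set (ℝ × ℝ)} (hS : MeasurableSet S)
    (hSB : S ⊆ Metric.closedBall c r) (hS0 : 0 < volume S) (hv : VanishesOn g S) :
    ∃ C : ℝ, ∀ δ : ℝ, 0 < δ → ∀ᶠ n in atTop,
      ∫ p in Metric.closedBall c r, (Real.log (g n p + δ) - Real.log δ) ≤ C := by
  let b : ContDiffBump c := ⟨r, 2 * r, hr, by linarith⟩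
  have hη : IsRealTest ω b :=
    ⟨b.contDiff, b.hasCompactSupport, b.tsupport_eq.trans_subset hc⟩
  have hη1 : ∀ p, b p ^ 2 ≤ 1 := fun p => pow_le_one₀ b.nonneg b.le_one
  set B := Metric.closedBall c r with hB
  have hBc : IsCompact B := isCompact_closedBall c r
  have hBm : MeasurableSet B := hBc.measurableSet
  have hBfin : volume B ≠ ⊤ := hBc.measure_ne_top
  have hSfin : volume S ≠ ⊤ := ((measure_mono hSB).trans_lt hBc.measure_lt_top).ne
  have hSpos : 0 < volume.real S := ENNReal.toReal_pos hS0.ne' hSfin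
  set H := ∫ p, gradSq b p with hH
  have hH0 : 0 ≤ H := integral_nonneg (gradSq_nonneg b)
  refine ⟨(volume.real B * (volume.real S + 1)
    + volume.real B * (2 * r) * (volume.real B + (4 * H + 2))) / volume.real S, fun δ hδ => ?_⟩
  set T := 8 / δ ^ 2 * H + 2 / δ ^ 4 * (E + 1) with hT
  have hT0 : 0 < T := by positivity
  filter_upwards [hg.energy.eventually_le_const (inv_pos.mpr hT0),
    hg.energy.eventually_le_const one_pos,
    hv.eventually_le_const (show (0 : ℝ) < δ ^ 2 by positivity)] with n hn1 hn2 hn3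
  have hgn := hg.test n
  have hg0 := hg.nonneg n
  have hpos : ∀ p, 0 < g n p + δ := fun p => by have := hg0 p; positivity
  set l : ℝ × ℝ → ℝ := fun p => Real.log (g n p + δ) - Real.log δ with hl
  have hls : ContDiff ℝ 1 l :=
    (((hgn.smooth.of_le (by simp)).add contDiff_const).log fun p => (hpos p).ne').sub contDiff_const
  have hld : ∀ p w, fderiv ℝ l p w = fderiv ℝ (g n) p w / (g n p + δ) := by
    intro p w
    have := (((hgn.differentiable p).hasFDerivAt.add_const δ).log (hpos p).ne').sub_const
      (Real.log δ)
    have h2 : HasFDerivAt l _ p := this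
    rw [h2.fderiv]
    simp
    field_simp
  have hX := integral_log_gradient_le hE hk hgn hg0 hη hη1 hδ (inv_pos.mpr hT0)
  rw [hg.norm_eq n, mul_one] at hX
  set X := ∫ p, b p ^ 2 * (gradSq (g n) p / (g n p + δ) ^ 2) with hXdef
  have hXle : X ≤ 4 * H + 2 := by
    have h1 : 8 / δ ^ 2 * H + 2 / δ ^ 4 * ∫ p, gradSq (g n) p ≤ T := by
      rw [hT]
      gcongr
      linarith
    have h2 : T⁻¹ ^ 2 * (8 / δ ^ 2 * H + 2 / δ ^ 4 * ∫ p, gradSq (g n) p) ≤ T⁻¹ := by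
      calc _ ≤ T⁻¹ ^ 2 * T := by gcongr
        _ = T⁻¹ := by field_simp
    have h3 : T⁻¹ * X ≤ T⁻¹ * (4 * H + 2) := by linarith
    exact le_of_mul_le_mul_left h3 (inv_pos.mpr hT0)
  have hcd := hls.continuous_fderiv (by simp)
  have hi1 : IntegrableOn (fun p => |fderiv ℝ l p (1, 0)|) B :=
    (by fun_prop : Continuous fun p => |fderiv ℝ l p (1, 0)|).continuousOn.integrableOn_compact hBc
  have hi2 : IntegrableOn (fun p => |fderiv ℝ l p (0, 1)|) B :=
    (by fun_prop : Continuous fun p => |fderiv ℝ l p (0, 1)|).continuousOn.integrableOn_compact hBc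
  have hi3 := hgn.integrable_mul_div hη hg0 hδ
  have hcB : ∀ t : ℝ, IntegrableOn (fun _ => t) B := fun t => integrableOn_const hBfin
  have hcS : ∀ t : ℝ, IntegrableOn (fun _ => t) S := fun t => integrableOn_const hSfin
  have hgrad : (∫ p in B, |fderiv ℝ l p (1, 0)|) + (∫ p in B, |fderiv ℝ l p (0, 1)|)
      ≤ volume.real B + X := by
    rw [← integral_add hi1 hi2]
    have h1 : ∫ p in B, (|fderiv ℝ l p (1, 0)| + |fderiv ℝ l p (0, 1)|)
        ≤ ∫ p in B, (1 + b p ^ 2 * (gradSq (g n) p / (g n p + δ) ^ 2)) := by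
      refine setIntegral_mono_on (hi1.fun_add hi2) ((hcB 1).fun_add hi3.integrableOn) hBm
        fun p hp => ?_
      have hb1 : b p = 1 := b.one_of_mem_closedBall hp
      have hgs : gradSq (g n) p / (g n p + δ) ^ 2
          = |fderiv ℝ l p (1, 0)| ^ 2 + |fderiv ℝ l p (0, 1)| ^ 2 := by
        rw [sq_abs, sq_abs, hld, hld, gradSq, div_pow, div_pow, add_div]
      rw [hb1, hgs]
      nlinarith [sq_nonneg (|fderiv ℝ l p (1, 0)| - 1), sq_nonneg (|fderiv ℝ l p (0, 1)| - 1)]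
    rw [integral_add (hcB 1) hi3.integrableOn] at h1
    have h2 : ∫ p in B, b p ^ 2 * (gradSq (g n) p / (g n p + δ) ^ 2) ≤ X :=
      setIntegral_le_integral hi3 (ae_of_all _ fun p => by
        have := gradSq_nonneg (g n) p
        simp only [Pi.zero_apply]
        positivity)
    simp only [setIntegral_const, smul_eq_mul, mul_one] at h1
    linarith
  have hlS : ∫ p in S, l p ≤ volume.real S + 1 := by
    have hi := hgn.integrable_pow (n := 2) (by norm_num)
    have h1 : ∫ p in S, l p ≤ ∫ p in S, (1 + (δ ^ 2)⁻¹ * g n p ^ 2) := by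
      refine setIntegral_mono_on ((hls.continuous.continuousOn.integrableOn_compact hBc).mono_set
        hSB) ((hcS 1).fun_add (hi.const_mul _).integrableOn) hS fun p _ => ?_
      have h2 : l p ≤ g n p / δ := by
        have h3 : l p = Real.log ((g n p + δ) / δ) := by
          rw [Real.log_div (hpos p).ne' hδ.ne']
        rw [h3]
        have := Real.log_le_sub_one_of_pos (div_pos (hpos p) hδ)
        rw [add_div, div_self hδ.ne'] at this ⊢
        linarith
      have h4 : (δ ^ 2)⁻¹ * g n p ^ 2 = (g n p / δ) ^ 2 := by field_simp
      rw [h4]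
      nlinarith [sq_nonneg (g n p / δ - 1), sq_nonneg (g n p / δ)]
    rw [integral_add (hcS 1) (hi.const_mul _).integrableOn, integral_const_mul] at h1
    simp only [setIntegral_const, smul_eq_mul, mul_one] at h1
    have h5 : (δ ^ 2)⁻¹ * ∫ p in S, g n p ^ 2 ≤ 1 := by
      rw [inv_mul_le_iff₀ (by positivity)]
      linarith
    linarith
  rw [le_div_iff₀ hSpos]
  have hP := measure_mul_setIntegral_le hls c hr.le hS hSB
  have h6 := mul_le_mul_of_nonneg_left hlS (measureReal_nonneg (μ := volume) (s := B))
  have h7 := mul_le_mul_of_nonneg_left (hgrad.trans (add_le_add_right hXle _))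
    (by positivity : 0 ≤ volume.real B * (2 * r))
  linarith

lemma eventually_integral_pow_four_le {ω : Set (ℝ × ℝ)} {E : ℝ} :
    ∃ C : ℝ, 0 ≤ C ∧ ∀ g : ℕ → ℝ × ℝ → ℝ, IsMinimizing ω E g →
      ∀ᶠ n in atTop, ∫ p, g n p ^ 4 ≤ C := by
  obtain ⟨C, hC, h⟩ := exists_integral_pow_four_le
  refine ⟨C * (2 + |E + 1|) ^ 2, by positivity, fun g hg => ?_⟩
  filter_upwards [hg.energy.eventually_le_const one_pos] with n hn
  refine (h ω _ (hg.test n)).trans ?_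
  have h0 : 0 ≤ ∫ p, gradSq (g n) p := integral_nonneg (gradSq_nonneg _)
  rw [hg.norm_eq n]
  gcongr
  · norm_num
  · exact le_trans (by linarith) (le_abs_self _)

lemma VanishesOn.closedBall {ω : Set (ℝ × ℝ)} {E : ℝ} (hE : 0 ≤ E)
    (hk : ∀ f, IsRealTest ω f → E * ∫ p, f p ^ 2 ≤ ∫ p, gradSq f p)
    {g : ℕ → ℝ × ℝ → ℝ} (hg : IsMinimizing ω E g) {c : ℝ × ℝ} {r : ℝ} (hr : 0 < r)
    (hc : Metric.closedBall c (2 * r) ⊆ ω) {S : Set (ℝ × ℝ)} (hS : MeasurableSet S)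
    (hSB : S ⊆ Metric.closedBall c r) (hS0 : 0 < volume S) (hv : VanishesOn g S) :
    VanishesOn g (Metric.closedBall c r) := by
  obtain ⟨C, hC⟩ := exists_eventually_integral_log_le hE hk hg hr hc hS hSB hS0 hv
  obtain ⟨D, hD0, hD⟩ := eventually_integral_pow_four_le (ω := ω) (E := E)
  set B := Metric.closedBall c r with hB
  have hBc : IsCompact B := isCompact_closedBall c r
  have hBfin : volume B ≠ ⊤ := hBc.measure_ne_top
  refine tendsto_order.2 ⟨fun a ha => Eventually.of_forall fun n =>
    ha.trans_le (integral_nonneg fun p => by positivity), fun ε hε => ?_⟩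
  set τ := √(ε / (4 * (volume.real B + 1))) with hτ
  have hτ0 : 0 < τ := by positivity
  have hτ2 : τ ^ 2 = ε / (4 * (volume.real B + 1)) := Real.sq_sqrt (by positivity)
  set κ := ε / (4 * (D + 1)) with hκ
  have hκ0 : 0 < κ := by positivity
  set M := 4 * (|C| + 1) / (κ * ε) with hM
  have hM0 : 0 < M := by positivity
  have hδ : 0 < τ * Real.exp (-M) := by positivity
  filter_upwards [hC _ hδ, hD g hg] with n hn1 hn2
  set δ := τ * Real.exp (-M) with hδdef
  have hgn := hg.test n
  have hg0 := hg.nonneg n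
  have hpos : ∀ p, 0 < g n p + δ := fun p => by have := hg0 p; positivity
  have hpt : ∀ p, g n p ^ 2 ≤ τ ^ 2 + κ * g n p ^ 4
      + (κ * M)⁻¹ * (Real.log (g n p + δ) - Real.log δ) := by
    intro p
    have hp := hg0 p
    have hl0 : 0 ≤ Real.log (g n p + δ) - Real.log δ :=
      sub_nonneg.2 (Real.log_le_log hδ (by linarith))
    rcases le_total (g n p) τ with h | h
    · have : g n p ^ 2 ≤ τ ^ 2 := by gcongr
      have h2 : 0 ≤ κ * g n p ^ 4 + (κ * M)⁻¹ * (Real.log (g n p + δ) - Real.log δ) := by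
        positivity
      linarith
    · have h1 : M ≤ Real.log (g n p + δ) - Real.log δ := by
        have h2 : Real.log δ = Real.log τ - M := by
          rw [hδdef, Real.log_mul hτ0.ne' (Real.exp_pos _).ne', Real.log_exp]
          ring
        have h3 : Real.log τ ≤ Real.log (g n p + δ) := Real.log_le_log hτ0 (by linarith)
        linarith
      have h4 : κ⁻¹ ≤ (κ * M)⁻¹ * (Real.log (g n p + δ) - Real.log δ) := by
        calc κ⁻¹ = (κ * M)⁻¹ * M := by field_simp
          _ ≤ _ := by gcongr
      have h5 : g n p ^ 2 ≤ κ * g n p ^ 4 + κ⁻¹ := by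
        have : κ * g n p ^ 4 + κ⁻¹ - g n p ^ 2
            = κ * (g n p ^ 2 - κ⁻¹ / 2) ^ 2 + 3 / 4 * κ⁻¹ := by
          field_simp
          ring
        have h6 : 0 ≤ κ * (g n p ^ 2 - κ⁻¹ / 2) ^ 2 + 3 / 4 * κ⁻¹ := by positivity
        linarith
      have := sq_nonneg τ
      linarith
  have hi2 := (hgn.integrable_pow (n := 2) (by norm_num)).integrableOn (s := B)
  have hi4 := hgn.integrable_pow (n := 4) (by norm_num)
  have hil : IntegrableOn (fun p => Real.log (g n p + δ) - Real.log δ) B := by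
    refine ContinuousOn.integrableOn_compact hBc (Continuous.continuousOn ?_)
    exact ((hgn.smooth.continuous.add continuous_const).log fun p => (hpos p).ne').sub
      continuous_const
  have hcB : ∀ t : ℝ, IntegrableOn (fun _ => t) B := fun t => integrableOn_const hBfin
  have h1 : ∫ p in B, g n p ^ 2 ≤ ∫ p in B, (τ ^ 2 + κ * g n p ^ 4
      + (κ * M)⁻¹ * (Real.log (g n p + δ) - Real.log δ)) :=
    setIntegral_mono hi2 (((hcB _).fun_add (hi4.const_mul κ).integrableOn).fun_add
      (hil.const_mul _)) hpt
  rw [integral_add ((hcB _).fun_add (hi4.const_mul κ).integrableOn) (hil.const_mul _),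
    integral_add (hcB _) (hi4.const_mul κ).integrableOn, integral_const_mul,
    integral_const_mul] at h1
  simp only [setIntegral_const, smul_eq_mul] at h1
  have hb1 : volume.real B * τ ^ 2 ≤ ε / 4 := by
    rw [hτ2, mul_div_assoc', div_le_div_iff₀ (by positivity) (by positivity)]
    nlinarith [measureReal_nonneg (μ := volume) (s := B)]
  have hb2 : κ * ∫ p in B, g n p ^ 4 ≤ ε / 4 := by
    have h2 : ∫ p in B, g n p ^ 4 ≤ D :=
      (setIntegral_le_integral hi4 (ae_of_all _ fun p => by simp only [Pi.zero_apply]; positivity)).trans hn2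
    calc _ ≤ κ * D := by gcongr
      _ ≤ ε / 4 := by
        rw [hκ, div_mul_eq_mul_div, div_le_div_iff₀ (by positivity) (by positivity)]
        nlinarith
  have hb3 : (κ * M)⁻¹ * ∫ p in B, (Real.log (g n p + δ) - Real.log δ) ≤ ε / 4 := by
    calc _ ≤ (κ * M)⁻¹ * (|C| + 1) := by
          gcongr
          linarith [le_abs_self C]
      _ = ε / 4 := by
          rw [hM]
          field_simp
  linarith

lemma VanishesOn.mono {ω : Set (ℝ × ℝ)} {E : ℝ} {g : ℕ → ℝ × ℝ → ℝ} (hg : IsMinimizing ω E g)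
    {S T : Set (ℝ × ℝ)} (hST : S ⊆ T) (hT : VanishesOn g T) : VanishesOn g S :=
  squeeze_zero (fun n => integral_nonneg fun p => by positivity)
    (fun n => setIntegral_mono_set ((hg.test n).integrable_pow two_ne_zero).integrableOn
      (ae_of_all _ fun p => by simp only [Pi.zero_apply]; positivity) hST.eventuallyLE) hT

lemma VanishesOn.union {ω : Set (ℝ × ℝ)} {E : ℝ} {g : ℕ → ℝ × ℝ → ℝ} (hg : IsMinimizing ω E g)
    {S T : Set (ℝ × ℝ)} (hS : VanishesOn g S) (hT : VanishesOn g T) : VanishesOn g (S ∪ T) := by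
  have h := Tendsto.add hS hT
  rw [add_zero] at h
  refine squeeze_zero (fun n => integral_nonneg fun p => by positivity) (fun n => ?_) h
  have hi := (hg.test n).integrable_pow two_ne_zero
  rw [← integral_add_measure hi.integrableOn hi.integrableOn]
  exact integral_mono_measure (Measure.restrict_union_le S T)
    (ae_of_all _ fun p => by simp only [Pi.zero_apply]; positivity)
    (hi.restrict.add_measure hi.restrict)

lemma VanishesOn.of_isCompact {ω : Set (ℝ × ℝ)} (hωo : IsOpen ω) (hωc : IsPreconnected ω)
    {E : ℝ} (hE : 0 ≤ E)
    (hk : ∀ f, IsRealTest ω f → E * ∫ p, f p ^ 2 ≤ ∫ p, gradSq f p)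
    {g : ℕ → ℝ × ℝ → ℝ} (hg : IsMinimizing ω E g) {A : Set (ℝ × ℝ)} (hA : MeasurableSet A)
    (hAω : A ⊆ ω) (hA0 : volume A ≠ 0) (hv : VanishesOn g A) {K : Set (ℝ × ℝ)}
    (hK : IsCompact K) (hKω : K ⊆ ω) : VanishesOn g K := by
  have hball : ∀ x ∈ ω, ∃ r, 0 < r ∧ Metric.closedBall x (2 * r) ⊆ ω := by
    intro x hx
    obtain ⟨r, hr, h⟩ := Metric.nhds_basis_closedBall.mem_iff.1 (hωo.mem_nhds hx)
    exact ⟨r / 2, by linarith, by rwa [mul_div_cancel₀ _ two_ne_zero]⟩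
  set U : Set (ℝ × ℝ) := {x | ∃ V ∈ nhds x, VanishesOn g V} with hU
  have hUo : IsOpen U := by
    rw [isOpen_iff_mem_nhds]
    rintro x ⟨V, hV, hvV⟩
    filter_upwards [eventually_mem_nhds_iff.2 hV] with y hy using ⟨V, hy, hvV⟩
  have hUne : (ω ∩ U).Nonempty := by
    obtain ⟨x, hx, hpos⟩ := exists_mem_forall_mem_nhdsWithin_pos_measure hA0
    obtain ⟨r, hr, hsub⟩ := hball x (hAω hx)
    refine ⟨x, hAω hx, Metric.closedBall x r, Metric.closedBall_mem_nhds x hr, ?_⟩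
    refine VanishesOn.closedBall hE hk hg hr hsub
      (hA.inter Metric.isClosed_closedBall.measurableSet) inter_subset_right ?_
      (hv.mono hg inter_subset_left)
    exact hpos _ (inter_mem_nhdsWithin _ (Metric.closedBall_mem_nhds x hr))
  have hsubU : ω ⊆ U := by
    refine hωc.subset_of_closure_inter_subset hUo hUne ?_
    rintro x ⟨hxU, hxω⟩
    obtain ⟨r, hr, hsub⟩ := hball x hxω
    obtain ⟨y, hyx, V, hV, hvV⟩ := mem_closure_iff_nhds.1 hxU _ (Metric.ball_mem_nhds x hr)
    refine ⟨Metric.closedBall x r, Metric.closedBall_mem_nhds x hr, ?_⟩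
    have hVy : V ∩ Metric.ball x r ∈ nhds y := inter_mem hV (Metric.isOpen_ball.mem_nhds hyx)
    obtain ⟨W, hWsub, hWo, hyW⟩ := mem_nhds_iff.1 hVy
    exact VanishesOn.closedBall hE hk hg hr hsub hWo.measurableSet
      (hWsub.trans (inter_subset_right.trans Metric.ball_subset_closedBall))
      (hWo.measure_pos _ ⟨y, hyW⟩) (hvV.mono hg (hWsub.trans inter_subset_left))
  refine hK.induction_on (p := VanishesOn g) ?_ (fun s t h ht => ht.mono hg h)
    (fun s t hs ht => hs.union hg ht) fun x hx => ?_
  · simp [VanishesOn]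
  · obtain ⟨V, hV, hvV⟩ := hsubU (hKω hx)
    exact ⟨V, mem_nhdsWithin_of_mem_nhds hV, hvV⟩

/-- A minimizing sequence cannot vanish on a set of positive measure. -/
lemma not_vanishesOn {ω : Set (ℝ × ℝ)} (hωo : IsOpen ω) (hωb : Bornology.IsBounded ω)
    (hωc : IsPreconnected ω) {E : ℝ} (hE : 0 ≤ E)
    (hk : ∀ f, IsRealTest ω f → E * ∫ p, f p ^ 2 ≤ ∫ p, gradSq f p)
    {g : ℕ → ℝ × ℝ → ℝ} (hg : IsMinimizing ω E g) {A : Set (ℝ × ℝ)} (hA : MeasurableSet A)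
    (hAω : A ⊆ ω) (hA0 : volume A ≠ 0) : ¬ VanishesOn g A := by
  intro hv
  obtain ⟨D, hD0, hD⟩ := eventually_integral_pow_four_le (ω := ω) (E := E)
  set κ := 1 / (4 * (D + 1)) with hκ
  have hκ0 : 0 < κ := by positivity
  have hωfin : volume ω ≠ ⊤ := hωb.measure_lt_top.ne
  obtain ⟨K, hKω, hKc, hKm⟩ := hωo.measurableSet.exists_isCompact_sdiff_lt hωfin
    (ε := ENNReal.ofReal (κ / 4)) (by simpa using hκ0)
  have hvK := VanishesOn.of_isCompact hωo hωc hE hk hg hA hAω hA0 hv hKc hKω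
  obtain ⟨n, hn1, hn2⟩ := ((hD g hg).and
    (hvK.eventually_le_const (show (0 : ℝ) < 1 / 4 by norm_num))).exists
  have hgn := hg.test n
  have hi2 := hgn.integrable_pow (n := 2) two_ne_zero
  have hi4 := hgn.integrable_pow (n := 4) (by norm_num)
  have hdfin : volume (ω \ K) ≠ ⊤ := (hKm.trans ENNReal.ofReal_lt_top).ne
  have hdm : volume.real (ω \ K) ≤ κ / 4 :=
    ENNReal.toReal_le_of_le_ofReal (by positivity) hKm.le
  have hcS : ∀ t : ℝ, IntegrableOn (fun _ => t) (ω \ K) := fun t => integrableOn_const hdfin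
  have h1 : ∫ p in ω \ K, g n p ^ 2 ≤ ∫ p in ω \ K, (κ⁻¹ + κ * g n p ^ 4) := by
    refine setIntegral_mono hi2.integrableOn ((hcS _).fun_add (hi4.const_mul κ).integrableOn)
      fun p => ?_
    have h2 : κ⁻¹ + κ * g n p ^ 4 - g n p ^ 2
        = κ * (g n p ^ 2 - κ⁻¹ / 2) ^ 2 + 3 / 4 * κ⁻¹ := by
      field_simp
      ring
    have h6 : 0 ≤ κ * (g n p ^ 2 - κ⁻¹ / 2) ^ 2 + 3 / 4 * κ⁻¹ := by positivity
    show g n p ^ 2 ≤ κ⁻¹ + κ * g n p ^ 4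
    linarith
  rw [integral_add (hcS _) (hi4.const_mul κ).integrableOn, integral_const_mul] at h1
  simp only [setIntegral_const, smul_eq_mul] at h1
  have h3 : volume.real (ω \ K) * κ⁻¹ ≤ 1 / 4 := by
    calc _ ≤ κ / 4 * κ⁻¹ := by gcongr
      _ = 1 / 4 := by field_simp
  have h4 : κ * ∫ p in ω \ K, g n p ^ 4 ≤ 1 / 4 := by
    have h2 : ∫ p in ω \ K, g n p ^ 4 ≤ D :=
      (setIntegral_le_integral hi4
        (ae_of_all _ fun p => by simp only [Pi.zero_apply]; positivity)).trans hn1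
    calc _ ≤ κ * D := by gcongr
      _ ≤ 1 / 4 := by
        rw [hκ, div_mul_eq_mul_div, div_le_div_iff₀ (by positivity) (by positivity)]
        nlinarith
  have h5 : ∫ p in ω, g n p ^ 2 = 1 := by
    rw [setIntegral_eq_integral_of_forall_compl_eq_zero, hg.norm_eq n]
    intro p hp
    rw [image_eq_zero_of_notMem_tsupport fun h => hp (hgn.subset h)]
    norm_num
  have h6 := integral_inter_add_sdiff (s := ω) (t := K) hKc.measurableSet
    (hi2.integrableOn (s := ω))
  rw [inter_eq_self_of_subset_right hKω] at h6
  linarith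

lemma exists_gap_of_nonneg {ω : Set (ℝ × ℝ)} (hωo : IsOpen ω) (hωb : Bornology.IsBounded ω)
    (hωc : IsPreconnected ω) {E : ℝ} (hE : 0 ≤ E)
    (hk : ∀ f, IsRealTest ω f → E * ∫ p, f p ^ 2 ≤ ∫ p, gradSq f p)
    {A : Set (ℝ × ℝ)} (hA : MeasurableSet A) (hAω : A ⊆ ω) (hA0 : volume A ≠ 0) :
    ∃ c : ℝ, 0 < c ∧ ∀ g, IsRealTest ω g → (∀ p, 0 ≤ g p) →
      c * ∫ p, g p ^ 2 ≤ (∫ p, gradSq g p) - E * (∫ p, g p ^ 2) + ∫ p in A, g p ^ 2 := by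
  by_contra! hcon
  choose f hft hf0 hf using fun n : ℕ => hcon (1 / ((n : ℝ) + 1)) (by positivity)
  have hA_nn : ∀ n, 0 ≤ ∫ p in A, f n p ^ 2 := fun n => integral_nonneg fun p => by positivity
  have hNpos : ∀ n, 0 < ∫ p, f n p ^ 2 := by
    intro n
    have h1 := hk _ (hft n)
    have h2 := hA_nn n
    have h3 := hf n
    have h4 : 0 < 1 / ((n : ℝ) + 1) * ∫ p, f n p ^ 2 := by linarith
    exact pos_of_mul_pos_right h4 (by positivity)
  set a : ℕ → ℝ := fun n => (√(∫ p, f n p ^ 2))⁻¹ with ha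
  have ha2 : ∀ n, a n ^ 2 * ∫ p, f n p ^ 2 = 1 := by
    intro n
    rw [ha, inv_pow, Real.sq_sqrt (hNpos n).le, inv_mul_cancel₀ (hNpos n).ne']
  set g : ℕ → ℝ × ℝ → ℝ := fun n p => a n * f n p with hgdef
  have hgrad : ∀ n p, gradSq (g n) p = a n ^ 2 * gradSq (f n) p := by
    intro n p
    have := ((hft n).differentiable p).hasFDerivAt.const_mul (a n)
    simp only [gradSq, hgdef, this.fderiv]
    simp
    ring
  have hsq : ∀ n p, g n p ^ 2 = a n ^ 2 * f n p ^ 2 := fun n p => mul_pow _ _ _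
  have hsum : ∀ n, ((∫ p, gradSq (g n) p) - E) + ∫ p in A, g n p ^ 2 ≤ 1 / ((n : ℝ) + 1) := by
    intro n
    simp only [hgrad, hsq, integral_const_mul]
    have := mul_le_mul_of_nonneg_left (hf n).le (sq_nonneg (a n))
    have h1 := ha2 n
    have h2 : a n ^ 2 * (1 / ((n : ℝ) + 1) * ∫ p, f n p ^ 2) = 1 / ((n : ℝ) + 1) := by
      rw [mul_left_comm, h1, mul_one]
    rw [h2] at this
    have h3 : a n ^ 2 * (E * ∫ p, f n p ^ 2) = E := by
      rw [mul_left_comm, h1, mul_one]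
    linarith
  have hgt : ∀ n, IsRealTest ω (g n) := fun n => (hft n).const_mul _
  have hnorm : ∀ n, ∫ p, g n p ^ 2 = 1 := fun n => by
    simp only [hsq, integral_const_mul, ha2]
  have hen : ∀ n, 0 ≤ (∫ p, gradSq (g n) p) - E := fun n => by
    have := hk _ (hgt n)
    rw [hnorm n] at this
    linarith
  have hgA : ∀ n, 0 ≤ ∫ p in A, g n p ^ 2 := fun n => integral_nonneg fun p => by positivity
  have hlim := tendsto_one_div_add_atTop_nhds_zero_nat (𝕜 := ℝ)
  have hmin : IsMinimizing ω E g :=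
    { test := hgt
      nonneg := fun n p => mul_nonneg (by simp only [ha]; positivity) (hf0 n p)
      norm_eq := hnorm
      energy := squeeze_zero hen (fun n => by linarith [hsum n, hgA n]) hlim }
  exact not_vanishesOn hωo hωb hωc hE hk hmin hA hAω hA0
    (squeeze_zero hgA (fun n => by linarith [hsum n, hen n]) hlim)

/-- Squared length of the gradient of a complex function on the plane. -/
def normGradSq (f : ℝ × ℝ → ℂ) (p : ℝ × ℝ) : ℝ := ‖pd1' f p‖ ^ 2 + ‖pd2' f p‖ ^ 2

lemma normGradSq_nonneg (f : ℝ × ℝ → ℂ) (p : ℝ × ℝ) : 0 ≤ normGradSq f p := by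
  unfold normGradSq; positivity

lemma pd1'_eq_fderiv {f : ℝ × ℝ → ℂ} {p : ℝ × ℝ} (hf : DifferentiableAt ℝ f p) :
    pd1' f p = fderiv ℝ f p (1, 0) :=
  (hf.hasFDerivAt.comp_hasDerivAt (f := fun t => (t, p.2)) p.1
    ((hasDerivAt_id p.1).prodMk (hasDerivAt_const p.1 p.2))).deriv

lemma pd2'_eq_fderiv {f : ℝ × ℝ → ℂ} {p : ℝ × ℝ} (hf : DifferentiableAt ℝ f p) :
    pd2' f p = fderiv ℝ f p (0, 1) :=
  (hf.hasFDerivAt.comp_hasDerivAt (f := fun t => (p.1, t)) p.2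
    ((hasDerivAt_const p.2 p.1).prodMk (hasDerivAt_id p.2))).deriv

namespace IsTest2

variable {ω : Set (ℝ × ℝ)} {f : ℝ × ℝ → ℂ}

lemma differentiable (hf : IsTest2 ω f) : Differentiable ℝ f :=
  hf.1.differentiable (by simp)

lemma normGradSq_eq (hf : IsTest2 ω f) (p : ℝ × ℝ) :
    normGradSq f p = ‖fderiv ℝ f p (1, 0)‖ ^ 2 + ‖fderiv ℝ f p (0, 1)‖ ^ 2 := by
  rw [normGradSq, pd1'_eq_fderiv (hf.differentiable p), pd2'_eq_fderiv (hf.differentiable p)]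

lemma integrable_normGradSq (hf : IsTest2 ω f) : Integrable (normGradSq f) := by
  have h : Continuous (fderiv ℝ f) := hf.1.continuous_fderiv (by simp)
  refine Continuous.integrable_of_hasCompactSupport ?_ ?_
  · rw [funext hf.normGradSq_eq]
    fun_prop
  · refine (hf.2.1.fderiv (𝕜 := ℝ)).mono fun p hp => ?_
    contrapose! hp
    simp only [Function.mem_support, not_not] at hp ⊢
    simp [hf.normGradSq_eq, hp]

lemma integrable_norm_pow (hf : IsTest2 ω f) {n : ℕ} (hn : n ≠ 0) :
    Integrable (fun p => ‖f p‖ ^ n) := by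
  refine Continuous.integrable_of_hasCompactSupport (hf.1.continuous.norm.pow n) ?_
  refine hf.2.1.mono fun p hp => ?_
  contrapose! hp
  simp only [Function.mem_support, not_not] at hp ⊢
  simp [hp, hn]

lemma setIntegral_normGradSq (hf : IsTest2 ω f) :
    ∫ p in ω, normGradSq f p = ∫ p, normGradSq f p := by
  refine setIntegral_eq_integral_of_forall_compl_eq_zero fun p hp => ?_
  have h : fderiv ℝ f p = 0 := by
    by_contra h
    exact hp (hf.2.2 (support_fderiv_subset ℝ h))
  simp [hf.normGradSq_eq, h]

lemma setIntegral_norm_sq (hf : IsTest2 ω f) :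
    ∫ p in ω, ‖f p‖ ^ 2 = ∫ p, ‖f p‖ ^ 2 := by
  refine setIntegral_eq_integral_of_forall_compl_eq_zero fun p hp => ?_
  rw [image_eq_zero_of_notMem_tsupport fun h => hp (hf.2.2 h)]
  norm_num

lemma E1_mul_le (hf : IsTest2 ω f) :
    E1 ω * ∫ p, ‖f p‖ ^ 2 ≤ ∫ p, normGradSq f p := by
  by_cases h0 : f = 0
  · subst h0
    simpa using integral_nonneg (normGradSq_nonneg 0)
  have hN : 0 ≤ ∫ p, ‖f p‖ ^ 2 := integral_nonneg fun p => by positivity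
  rcases hN.eq_or_lt with hN | hN
  · rw [← hN, mul_zero]
    exact integral_nonneg (normGradSq_nonneg f)
  · rw [← le_div_iff₀ hN]
    refine csInf_le ⟨0, ?_⟩ ⟨f, hf, h0, ?_⟩
    · rintro r ⟨g, -, -, rfl⟩
      exact div_nonneg (integral_nonneg fun p => by positivity)
        (integral_nonneg fun p => by positivity)
    · rw [hf.setIntegral_norm_sq, ← hf.setIntegral_normGradSq]
      rfl

lemma ofReal {g : ℝ × ℝ → ℝ} (hg : IsRealTest ω g) : IsTest2 ω fun p => (g p : ℂ) :=
  ⟨Complex.ofRealCLM.contDiff.comp hg.smooth,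
    hg.compact.comp_left Complex.ofReal_zero,
    (tsupport_comp_subset Complex.ofReal_zero g).trans hg.subset⟩

end IsTest2

lemma E1_nonneg (ω : Set (ℝ × ℝ)) : 0 ≤ E1 ω := by
  refine Real.sInf_nonneg ?_
  rintro r ⟨g, -, -, rfl⟩
  exact div_nonneg (integral_nonneg fun p => by positivity)
    (integral_nonneg fun p => by positivity)

lemma IsRealTest.E1_mul_le {ω : Set (ℝ × ℝ)} {g : ℝ × ℝ → ℝ} (hg : IsRealTest ω g) :
    E1 ω * ∫ p, g p ^ 2 ≤ ∫ p, gradSq g p := by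
  have h := (IsTest2.ofReal hg).E1_mul_le
  have h2 : ∀ p, normGradSq (fun p => (g p : ℂ)) p = gradSq g p := by
    intro p
    have h3 : fderiv ℝ (fun p => (g p : ℂ)) p
        = Complex.ofRealCLM.comp (fderiv ℝ g p) :=
      (Complex.ofRealCLM.hasFDerivAt.comp p (hg.differentiable p).hasFDerivAt).fderiv
    rw [(IsTest2.ofReal hg).normGradSq_eq, h3]
    simp [gradSq]
  simpa [h2] using h

/-- The regularised modulus of a test function is a nonnegative real test function, with
pointwise control of its gradient (the diamagnetic inequality). -/
lemma IsTest2.exists_regularized_norm {ω : Set (ℝ × ℝ)} {f : ℝ × ℝ → ℂ} (hf : IsTest2 ω f)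
    {δ : ℝ} (hδ : 0 < δ) : ∃ g, IsRealTest ω g ∧ (∀ p, 0 ≤ g p) ∧ (∀ p, g p ^ 2 ≤ ‖f p‖ ^ 2) ∧
      (∀ p, ‖f p‖ ^ 2 - 2 * δ * ‖f p‖ ≤ g p ^ 2) ∧ ∀ p, gradSq g p ≤ normGradSq f p := by
  have hpos : ∀ p, 0 < ‖f p‖ ^ 2 + δ ^ 2 := fun p => by positivity
  have hge : ∀ p, δ ≤ √(‖f p‖ ^ 2 + δ ^ 2) := fun p =>
    Real.le_sqrt_of_sq_le (by linarith [sq_nonneg ‖f p‖])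
  have hle : ∀ p, √(‖f p‖ ^ 2 + δ ^ 2) - δ ≤ ‖f p‖ := fun p => by
    rw [sub_le_iff_le_add]
    refine Real.sqrt_le_iff.2 ⟨by positivity, ?_⟩
    nlinarith [mul_nonneg (norm_nonneg (f p)) hδ.le]
  have hsupp : Function.support (fun p => √(‖f p‖ ^ 2 + δ ^ 2) - δ) ⊆ Function.support f := by
    intro p hp
    contrapose! hp
    simp only [Function.mem_support, not_not] at hp ⊢
    simp [hp, hδ.le]
  have hsm : ContDiff ℝ (⊤ : ℕ∞) fun p => √(‖f p‖ ^ 2 + δ ^ 2) - δ :=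
    (((hf.1.norm_sq ℝ).add contDiff_const).sqrt fun p => (hpos p).ne').sub contDiff_const
  refine ⟨fun p => √(‖f p‖ ^ 2 + δ ^ 2) - δ, ⟨hsm, hf.2.1.mono hsupp,
    (closure_mono hsupp).trans hf.2.2⟩, fun p => sub_nonneg.2 (hge p), fun p => ?_, fun p => ?_,
    fun p => ?_⟩
  · exact pow_le_pow_left₀ (sub_nonneg.2 (hge p)) (hle p) 2
  · nlinarith [Real.sq_sqrt (hpos p).le, hle p]
  · have hD : ∀ w, (fderiv ℝ (fun p => √(‖f p‖ ^ 2 + δ ^ 2) - δ) p w) ^ 2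
        ≤ ‖fderiv ℝ f p w‖ ^ 2 := by
      intro w
      have h1 : HasFDerivAt (fun p => √(‖f p‖ ^ 2 + δ ^ 2) - δ) _ p :=
        ((((hf.differentiable p).hasFDerivAt.norm_sq).add_const (δ ^ 2)).sqrt
          (hpos p).ne').sub_const δ
      have h2 : fderiv ℝ (fun p => √(‖f p‖ ^ 2 + δ ^ 2) - δ) p w
          = inner ℝ (f p) (fderiv ℝ f p w) / √(‖f p‖ ^ 2 + δ ^ 2) := by
        rw [h1.fderiv]
        simp
        field_simp
      rw [h2, div_pow, Real.sq_sqrt (hpos p).le, div_le_iff₀ (hpos p)]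
      have h3 := pow_le_pow_left₀ (abs_nonneg _) (abs_real_inner_le_norm (f p) (fderiv ℝ f p w)) 2
      rw [sq_abs, mul_pow] at h3
      nlinarith [mul_nonneg (sq_nonneg ‖fderiv ℝ f p w‖) (sq_nonneg δ)]
    rw [hf.normGradSq_eq]
    exact add_le_add (hD _) (hD _)

/-- The gap inequality for complex test functions on the cross-section. -/
lemma exists_gap {ω : Set (ℝ × ℝ)} (hωo : IsOpen ω) (hωb : Bornology.IsBounded ω)
    (hωc : IsPreconnected ω) {A : Set (ℝ × ℝ)} (hA : MeasurableSet A) (hAω : A ⊆ ω)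
    (hA0 : volume A ≠ 0) :
    ∃ c : ℝ, 0 < c ∧ ∀ f, IsTest2 ω f → c * ∫ p, ‖f p‖ ^ 2
      ≤ (∫ p, normGradSq f p) - E1 ω * (∫ p, ‖f p‖ ^ 2) + ∫ p in A, ‖f p‖ ^ 2 := by
  obtain ⟨c, hc0, hc⟩ := exists_gap_of_nonneg hωo hωb hωc (E1_nonneg ω)
    (fun g hg => hg.E1_mul_le) hA hAω hA0
  refine ⟨c, hc0, fun f hf => le_of_forall_pos_le_add fun ε hε => ?_⟩
  set L := ∫ p, ‖f p‖ with hL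
  have hL0 : 0 ≤ L := integral_nonneg fun p => norm_nonneg _
  have hE := E1_nonneg ω
  set K := 2 * (c + E1 ω) * L with hK
  have hK0 : 0 ≤ K := by positivity
  set δ := ε / (K + 1) with hδ
  have hδ0 : 0 < δ := by positivity
  have hδK : δ * K ≤ ε := by
    rw [hδ, div_mul_eq_mul_div, div_le_iff₀ (by positivity)]
    nlinarith
  obtain ⟨g, hg, hg0, hgle, hgge, hgrad⟩ := hf.exists_regularized_norm hδ0
  have hif := hf.integrable_norm_pow two_ne_zero
  have hif1 : Integrable fun p => ‖f p‖ := by simpa using hf.integrable_norm_pow one_ne_zero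
  have hig := hg.integrable_pow two_ne_zero
  have h1 : ∫ p, gradSq g p ≤ ∫ p, normGradSq f p :=
    integral_mono hg.integrable_gradSq hf.integrable_normGradSq hgrad
  have h2 : ∫ p in A, g p ^ 2 ≤ ∫ p in A, ‖f p‖ ^ 2 :=
    integral_mono hig.integrableOn hif.integrableOn hgle
  have h3 : (∫ p, ‖f p‖ ^ 2) - 2 * δ * L ≤ ∫ p, g p ^ 2 := by
    rw [hL, ← integral_const_mul, ← integral_sub hif (hif1.const_mul _)]
    exact integral_mono (hif.sub (hif1.const_mul _)) hig hgge
  have h4 := hc g hg hg0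
  have h5 := mul_le_mul_of_nonneg_left h3 hc0.le
  have h6 := mul_le_mul_of_nonneg_left h3 hE
  have h7 : 2 * δ * L * (c + E1 ω) ≤ ε := by
    calc _ = δ * K := by rw [hK]; ring
      _ ≤ ε := hδK
  linarith

lemma rot_zero (p : ℝ × ℝ) : rot 0 p = p := by simp [rot]

lemma rot_rot (α β : ℝ) (p : ℝ × ℝ) : rot α (rot β p) = rot (α + β) p := by
  ext <;> simp only [rot, Real.cos_add, Real.sin_add] <;> ring

lemma hasDerivAt_rot (α : ℝ) (p : ℝ × ℝ) :
    HasDerivAt (fun α => rot α p) ((rot α p).2, -(rot α p).1) α := by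
  have h1 := ((Real.hasDerivAt_cos α).const_mul p.1).fun_add ((Real.hasDerivAt_sin α).const_mul p.2)
  have h2 := ((Real.hasDerivAt_sin α).const_mul (-p.1)).fun_add
    ((Real.hasDerivAt_cos α).const_mul p.2)
  refine (h1.prodMk h2).congr_deriv ?_
  ext <;> simp only [rot] <;> ring

lemma continuous_rot_uncurry : Continuous fun q : ℝ × (ℝ × ℝ) => rot q.1 q.2 := by
  unfold rot
  fun_prop

lemma measurePreserving_rot (α : ℝ) : MeasurePreserving (rot α) := by
  have hdet : (!![Real.cos α, Real.sin α; -Real.sin α, Real.cos α] :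
      Matrix (Fin 2) (Fin 2) ℝ).det = 1 := by
    rw [Matrix.det_fin_two_of]
    linarith [Real.sin_sq_add_cos_sq α]
  set f := Matrix.toLin (Module.Basis.finTwoProd ℝ) (Module.Basis.finTwoProd ℝ)
    !![Real.cos α, Real.sin α; -Real.sin α, Real.cos α] with hf
  have hfr : (rot α) = f := by
    funext p
    rw [hf, Matrix.toLin_finTwoProd_apply]
    ext <;> simp only [rot] <;> ring
  have hfd : LinearMap.det f = 1 := by rw [hf, LinearMap.det_toLin, hdet]
  refine ⟨by unfold rot; fun_prop, ?_⟩
  rw [hfr, Measure.map_linearMap_addHaar_eq_smul_addHaar _ (by rw [hfd]; norm_num), hfd]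
  simp

lemma image_rot (α : ℝ) (s : Set (ℝ × ℝ)) : rot α '' s = rot (-α) ⁻¹' s := by
  refine congrFun (image_eq_preimage_of_inverse (fun p => ?_) (fun p => ?_)) s
  · rw [rot_rot, neg_add_cancel, rot_zero]
  · rw [rot_rot, add_neg_cancel, rot_zero]

/-- The rotations preserving `ω` up to null sets. -/
def rotSymmetries (ω : Set (ℝ × ℝ)) : AddSubgroup ℝ where
  carrier := {α | rot α ⁻¹' ω =ᵐ[volume] ω}
  zero_mem' := by
    have : rot 0 ⁻¹' ω = ω := by ext p; simp [rot_zero]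
    rw [mem_ofPred_eq, this]
    exact EventuallyEq.rfl
  add_mem' := by
    intro α β hα hβ
    have h := (measurePreserving_rot β).quasiMeasurePreserving.preimage_ae_eq hα
    have h2 : rot β ⁻¹' (rot α ⁻¹' ω) = rot (α + β) ⁻¹' ω := by
      ext p; simp [rot_rot]
    rw [h2] at h
    exact h.trans hβ
  neg_mem' := by
    intro α hα
    have h := (measurePreserving_rot (-α)).quasiMeasurePreserving.preimage_ae_eq hα
    have h2 : rot (-α) ⁻¹' (rot α ⁻¹' ω) = ω := by
      ext p; simp [rot_rot, rot_zero]
    rw [h2] at h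
    exact h.symm

/-- If the twist `γ` starts at `0` and is not constant, some `γ t` moves a part of `ω` of positive
measure out of `ω`. -/
lemma exists_measure_sdiff_rot_ne_zero {ω : Set (ℝ × ℝ)} (hω : IsOpen ω)
    (hb : Bornology.IsBounded ω) {γ : ℝ → ℝ} (hγ : Continuous γ) {a b : ℝ} (ha : γ a = 0)
    (hb0 : γ b ≠ 0) {ϑ : ℝ} (hϑ : volume (symmDiff (rot ϑ '' ω) ω) ≠ 0) :
    ∃ t, volume (ω \ rot (γ t) ⁻¹' ω) ≠ 0 := by
  by_contra! hcon
  have hmem : ∀ t, γ t ∈ rotSymmetries ω := by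
    intro t
    have hmp := measurePreserving_rot (γ t)
    have hle : ω ≤ᵐ[volume] rot (γ t) ⁻¹' ω := ae_le_set.2 (hcon t)
    have := ae_eq_of_ae_subset_of_measure_ge hle
      (hmp.measure_preimage hω.measurableSet.nullMeasurableSet).le
      hω.measurableSet.nullMeasurableSet
      (by rw [hmp.measure_preimage hω.measurableSet.nullMeasurableSet]
          exact hb.measure_lt_top.ne)
    exact this.symm
  have hmem_all : -ϑ ∈ rotSymmetries ω := by
    obtain ⟨n, hn⟩ := exists_nat_gt (|ϑ| / |γ b|)
    have hγb : 0 < |γ b| := abs_pos.2 hb0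
    have hn0 : (0 : ℝ) < n := lt_of_le_of_lt (by positivity) hn
    rw [div_lt_iff₀ hγb] at hn
    have hr : |ϑ| / n ∈ rotSymmetries ω := by
      have hIVT := intermediate_value_uIcc (a := a) (b := b) hγ.abs.continuousOn
      have hin : |ϑ| / n ∈ uIcc |γ a| |γ b| := by
        rw [ha, abs_zero, uIcc_of_le hγb.le]
        exact ⟨by positivity, by rw [div_le_iff₀ hn0]; linarith⟩
      obtain ⟨t, -, ht⟩ := hIVT hin
      simp only at ht
      rw [← ht]
      rcases abs_choice (γ t) with h | h <;> rw [h]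
      · exact hmem t
      · exact neg_mem (hmem t)
    have h2 : |ϑ| ∈ rotSymmetries ω := by
      have := nsmul_mem hr n
      rwa [nsmul_eq_mul, mul_div_cancel₀ _ hn0.ne'] at this
    rcases abs_choice ϑ with h | h <;> rw [h] at h2
    · exact neg_mem h2
    · exact h2
  refine hϑ ?_
  rw [image_rot]
  exact measure_symmDiff_eq_zero_iff.2 hmem_all

lemma intervalIntegral_hardy {u u' : ℝ → ℂ} (hu : ∀ s, HasDerivAt u (u' s) s)
    (hu' : Continuous u') {a b : ℝ} (hab : a ≤ b) :
    ∫ s in a..b, ‖u s‖ ^ 2 / (1 + (s - a)) ^ 2 ≤ 2 * ‖u a‖ ^ 2 + 4 * ∫ s in a..b, ‖u' s‖ ^ 2 := by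
  have huc : Continuous u := continuous_iff_continuousAt.2 fun s => (hu s).continuousAt
  have hpos : ∀ s ∈ uIcc a b, 0 < 1 + (s - a) := fun s hs => by
    rw [uIcc_of_le hab] at hs
    linarith [hs.1]
  set G : ℝ → ℝ := fun s => ‖u s‖ ^ 2 / (1 + (s - a)) ^ 2 - 2 * inner ℝ (u s) (u' s) / (1 + (s - a))
    with hG
  have hder : ∀ s ∈ uIcc a b,
      HasDerivAt (fun s => -(‖u s‖ ^ 2 / (1 + (s - a)))) (G s) s := by
    intro s hs
    have h := ((hu s).norm_sq.fun_div (((hasDerivAt_id s).sub_const a).const_add 1)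
      (hpos s hs).ne').fun_neg
    refine h.congr_deriv ?_
    have := (hpos s hs).ne'
    simp only [hG, id]
    field_simp
    ring
  have hi1 : IntervalIntegrable (fun s => ‖u s‖ ^ 2 / (1 + (s - a)) ^ 2) volume a b :=
    ContinuousOn.intervalIntegrable (ContinuousOn.div (by fun_prop) (by fun_prop)
      fun s hs => pow_ne_zero 2 (hpos s hs).ne')
  have hi2 : IntervalIntegrable (fun s => ‖u' s‖ ^ 2) volume a b :=
    (by fun_prop : Continuous fun s => ‖u' s‖ ^ 2).intervalIntegrable a b
  have hi3 : IntervalIntegrable G volume a b :=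
    hi1.sub (ContinuousOn.intervalIntegrable (ContinuousOn.div (by fun_prop) (by fun_prop)
      fun s hs => (hpos s hs).ne'))
  have hFTC := intervalIntegral.integral_eq_sub_of_hasDerivAt hder hi3
  have hmono : ∫ s in a..b, (1 / 2 * (‖u s‖ ^ 2 / (1 + (s - a)) ^ 2) - 2 * ‖u' s‖ ^ 2)
      ≤ ∫ s in a..b, G s := by
    refine intervalIntegral.integral_mono_on hab ((hi1.const_mul _).sub (hi2.const_mul _)) hi3
      fun s hs => ?_
    have h0 := hpos s (by rwa [uIcc_of_le hab])
    have h1 : inner ℝ (u s) (u' s) / (1 + (s - a)) ≤ ‖u s‖ / (1 + (s - a)) * ‖u' s‖ := by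
      rw [div_mul_eq_mul_div]
      gcongr
      exact real_inner_le_norm _ _
    have h2 := sq_nonneg (‖u s‖ / (1 + (s - a)) - 2 * ‖u' s‖)
    simp only [hG]
    rw [mul_div_assoc, ← div_pow]
    nlinarith
  rw [intervalIntegral.integral_sub (hi1.const_mul _) (hi2.const_mul _),
    intervalIntegral.integral_const_mul, intervalIntegral.integral_const_mul, hFTC] at hmono
  have h3 : 0 ≤ ‖u b‖ ^ 2 / (1 + (b - a)) :=
    div_nonneg (by positivity) (hpos b right_mem_uIcc).le
  simp only [sub_self, add_zero, div_one] at hmono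
  linarith

lemma integral_hardy {u u' : ℝ → ℂ} (hu : ∀ s, HasDerivAt u (u' s) s)
    (hu' : Continuous u') (hc : HasCompactSupport u) (a : ℝ) :
    ∫ s, ‖u s‖ ^ 2 / (1 + |s - a|) ^ 2 ≤ 4 * ‖u a‖ ^ 2 + 4 * ∫ s, ‖u' s‖ ^ 2 := by
  have huc : Continuous u := continuous_iff_continuousAt.2 fun s => (hu s).continuousAt
  obtain ⟨r, hr0, hr⟩ := hc.isCompact.isBounded.subset_ball_lt 0 a
  have hpos : ∀ s, (1 + |s - a|) ^ 2 ≠ 0 := fun s => by positivity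
  have hfc : Continuous fun s => ‖u s‖ ^ 2 / (1 + |s - a|) ^ 2 :=
    Continuous.div (by fun_prop) (by fun_prop) hpos
  have hgc : Continuous fun s => ‖u' s‖ ^ 2 := by fun_prop
  have hsub : ∀ s, u s ≠ 0 ∨ u' s ≠ 0 → s ∈ Ioc (a - r) (a + r) := by
    intro s hs
    have : s ∈ tsupport u := by
      rcases hs with hs | hs
      · exact subset_tsupport u hs
      · refine support_deriv_subset ?_
        rwa [Function.mem_support, (hu s).deriv]
    have := hr this
    rw [Real.ball_eq_Ioo] at this
    exact Ioo_subset_Ioc_self this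
  have hf : ∫ s in (a - r)..(a + r), ‖u s‖ ^ 2 / (1 + |s - a|) ^ 2
      = ∫ s, ‖u s‖ ^ 2 / (1 + |s - a|) ^ 2 := by
    refine intervalIntegral.integral_eq_integral_of_support_subset fun s hs => hsub s (Or.inl ?_)
    rintro h
    simp [h] at hs
  have hg : ∫ s in (a - r)..(a + r), ‖u' s‖ ^ 2 = ∫ s, ‖u' s‖ ^ 2 := by
    refine intervalIntegral.integral_eq_integral_of_support_subset fun s hs => hsub s (Or.inr ?_)
    rintro h
    simp [h] at hs
  rw [← hf, ← hg, ← intervalIntegral.integral_add_adjacent_intervals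
    (hfc.intervalIntegrable (a - r) a) (hfc.intervalIntegrable a (a + r)),
    ← intervalIntegral.integral_add_adjacent_intervals
    (hgc.intervalIntegrable (a - r) a) (hgc.intervalIntegrable a (a + r))]
  have h1 : ∫ s in a..(a + r), ‖u s‖ ^ 2 / (1 + |s - a|) ^ 2
      ≤ 2 * ‖u a‖ ^ 2 + 4 * ∫ s in a..(a + r), ‖u' s‖ ^ 2 := by
    refine le_trans (le_of_eq ?_) (intervalIntegral_hardy hu hu' (by linarith))
    refine intervalIntegral.integral_congr fun s hs => ?_
    rw [uIcc_of_le (by linarith)] at hs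
    simp only [abs_of_nonneg (sub_nonneg.2 hs.1)]
  have h2 : ∫ s in (a - r)..a, ‖u s‖ ^ 2 / (1 + |s - a|) ^ 2
      ≤ 2 * ‖u a‖ ^ 2 + 4 * ∫ s in (a - r)..a, ‖u' s‖ ^ 2 := by
    have hrefl : ∀ s, HasDerivAt (fun s => u (2 * a - s)) (-u' (2 * a - s)) s := fun s =>
      (hu (2 * a - s)).comp_const_sub (2 * a) s
    have h := intervalIntegral_hardy hrefl (by fun_prop) (a := a) (b := a + r) (by linarith)
    have e1 := intervalIntegral.integral_comp_sub_left
      (fun s => ‖u s‖ ^ 2 / (1 + |s - a|) ^ 2) (2 * a) (a := a) (b := a + r)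
    have e2 := intervalIntegral.integral_comp_sub_left
      (fun s => ‖u' s‖ ^ 2) (2 * a) (a := a) (b := a + r)
    have e3 : 2 * a - (a + r) = a - r := by ring
    have e4 : 2 * a - a = a := by ring
    simp only [norm_neg, e4] at h
    rw [e3, e4] at e1 e2
    rw [e2] at h
    rw [← e1]
    refine le_trans (le_of_eq ?_) h
    refine intervalIntegral.integral_congr fun s hs => ?_
    rw [uIcc_of_le (by linarith)] at hs
    have e5 : |2 * a - s - a| = s - a := by
      rw [abs_of_nonpos (by linarith [hs.1])]
      ring
    simp only [e5]
  linarith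

lemma norm_sub_sq_le {u u' : ℝ → ℂ} (hu : ∀ s, HasDerivAt u (u' s) s)
    (hu' : Continuous u') (hc : HasCompactSupport u) (s t : ℝ) :
    ‖u s - u t‖ ^ 2 ≤ |s - t| * ∫ r, ‖u' r‖ ^ 2 := by
  wlog hst : t < s generalizing s t
  · rcases (not_lt.1 hst).eq_or_lt with h | h
    · simp [h]
    · rw [norm_sub_rev, abs_sub_comm]
      exact this t s h
  have hc' : HasCompactSupport u' := by
    have : deriv u = u' := funext fun s => (hu s).deriv
    rw [← this]
    exact hc.deriv
  have hint : Integrable fun r => ‖u' r‖ ^ 2 :=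
    (by fun_prop : Continuous fun r => ‖u' r‖ ^ 2).integrable_of_hasCompactSupport
      (hc'.mono fun r hr h => hr (by simp [h]))
  have h1 : ‖u s - u t‖ ≤ ∫ r in t..s, ‖u' r‖ := by
    rw [← intervalIntegral.integral_eq_sub_of_hasDerivAt (fun r _ => hu r)
      (hu'.intervalIntegrable t s)]
    exact intervalIntegral.norm_integral_le_integral_norm hst.le
  set m := ∫ r in t..s, ‖u' r‖ with hm
  have h2 : 0 ≤ ∫ r in t..s, ((s - t) * ‖u' r‖ - m) ^ 2 :=
    intervalIntegral.integral_nonneg hst.le fun r _ => sq_nonneg _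
  have h3 : ∫ r in t..s, ((s - t) * ‖u' r‖ - m) ^ 2
      = (s - t) * ((s - t) * (∫ r in t..s, ‖u' r‖ ^ 2) - m ^ 2) := by
    have e : ∀ r, ((s - t) * ‖u' r‖ - m) ^ 2
        = (s - t) ^ 2 * ‖u' r‖ ^ 2 - 2 * (s - t) * m * ‖u' r‖ + m ^ 2 := fun r => by ring
    have hi1 : IntervalIntegrable (fun r => (s - t) ^ 2 * ‖u' r‖ ^ 2) volume t s :=
      (by fun_prop : Continuous _).intervalIntegrable t s
    have hi2 : IntervalIntegrable (fun r => 2 * (s - t) * m * ‖u' r‖) volume t s :=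
      (by fun_prop : Continuous _).intervalIntegrable t s
    simp only [e]
    rw [intervalIntegral.integral_add (hi1.sub hi2) intervalIntegrable_const,
      intervalIntegral.integral_sub hi1 hi2, intervalIntegral.integral_const_mul,
      intervalIntegral.integral_const_mul, intervalIntegral.integral_const, ← hm, smul_eq_mul]
    ring
  rw [h3] at h2
  have h4 : m ^ 2 ≤ (s - t) * ∫ r in t..s, ‖u' r‖ ^ 2 := by
    have := nonneg_of_mul_nonneg_right h2 (sub_pos.2 hst)
    linarith
  have h5 : ∫ r in t..s, ‖u' r‖ ^ 2 ≤ ∫ r, ‖u' r‖ ^ 2 := by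
    rw [intervalIntegral.integral_of_le hst.le]
    exact setIntegral_le_integral hint (ae_of_all _ fun r => by
      simp only [Pi.zero_apply]; positivity)
  rw [abs_of_pos (sub_pos.2 hst)]
  calc ‖u s - u t‖ ^ 2 ≤ m ^ 2 := by gcongr
    _ ≤ _ := h4
    _ ≤ _ := by
      have := sub_pos.2 hst
      gcongr

section slices

variable {F : Type*} [Zero F] {f : ℝ × ℝ × ℝ → F}

lemma HasCompactSupport.slice_left (hf : HasCompactSupport f) (s : ℝ) :
    HasCompactSupport fun y => f (s, y) :=
  hf.comp_isClosedEmbedding (g := fun y => (s, y)) <| Isometry.isClosedEmbedding <|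
    Isometry.of_dist_eq fun y z => by simp [Prod.dist_eq]

lemma HasCompactSupport.slice_right (hf : HasCompactSupport f) (y : ℝ × ℝ) :
    HasCompactSupport fun s => f (s, y) :=
  hf.comp_isClosedEmbedding (g := fun s => (s, y)) <| Isometry.isClosedEmbedding <|
    Isometry.of_dist_eq fun s t => by simp [Prod.dist_eq]

end slices

lemma integrable_norm_sq {X : Type*} [TopologicalSpace X] [MeasurableSpace X]
    [OpensMeasurableSpace X] {μ : Measure X} [IsFiniteMeasureOnCompacts μ] {f : X → ℂ}
    (hf : Continuous f) (hc : HasCompactSupport f) : Integrable (fun x => ‖f x‖ ^ 2) μ :=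
  (by fun_prop : Continuous fun x => ‖f x‖ ^ 2).integrable_of_hasCompactSupport
    (hc.mono fun x hx h => hx (by simp [h]))

lemma integrable_norm_sq_div {X : Type*} [TopologicalSpace X] [MeasurableSpace X]
    [OpensMeasurableSpace X] {μ : Measure X} [IsFiniteMeasureOnCompacts μ] {f : X → ℂ}
    (hf : Continuous f) (hc : HasCompactSupport f) {w : X → ℝ} (hw : Continuous w)
    (hw0 : ∀ x, w x ≠ 0) : Integrable (fun x => ‖f x‖ ^ 2 / w x) μ :=
  ((hf.norm.pow 2).div hw hw0).integrable_of_hasCompactSupport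
    (hc.mono fun x hx h => hx (by simp [h]))

/-- The longitudinal derivative `∂₁ψ - θ̇ ∂_τψ` of the twisted tube. -/
def twistedDeriv (θ : ℝ → ℝ) (ψ : ℝ × ℝ × ℝ → ℂ) (x : ℝ × ℝ × ℝ) : ℂ :=
  pd1 ψ x - deriv θ x.1 • pdtau ψ x

/-- The map turning the cross-section at `s` by the angle `γ s`. -/
def twist (γ : ℝ → ℝ) (hγ : Continuous γ) : (ℝ × ℝ × ℝ) ≃ₜ (ℝ × ℝ × ℝ) where
  toFun x := (x.1, rot (γ x.1) x.2)
  invFun x := (x.1, rot (-γ x.1) x.2)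
  left_inv x := by simp [rot_rot, rot_zero]
  right_inv x := by simp [rot_rot, rot_zero]
  continuous_toFun := continuous_fst.prodMk
    (continuous_rot_uncurry.comp ((hγ.comp continuous_fst).prodMk continuous_snd))
  continuous_invFun := continuous_fst.prodMk
    (continuous_rot_uncurry.comp ((hγ.neg.comp continuous_fst).prodMk continuous_snd))

lemma measurePreserving_twist (γ : ℝ → ℝ) (hγ : Continuous γ) :
    MeasurePreserving (twist γ hγ) := by
  refine (MeasurePreserving.id volume).skew_product (g := fun s y => rot (γ s) y) ?_
    (ae_of_all _ fun s => (measurePreserving_rot (γ s)).map_eq)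
  exact (continuous_rot_uncurry.comp ((hγ.comp continuous_fst).prodMk continuous_snd)).measurable

lemma integral_comp_twist (γ : ℝ → ℝ) (hγ : Continuous γ) (h : ℝ × ℝ × ℝ → ℝ) :
    ∫ x, h (twist γ hγ x) = ∫ x, h x :=
  (measurePreserving_twist γ hγ).integral_comp (twist γ hγ).measurableEmbedding h

lemma pd1_eq_fderiv {ψ : ℝ × ℝ × ℝ → ℂ} {x : ℝ × ℝ × ℝ} (h : DifferentiableAt ℝ ψ x) :
    pd1 ψ x = fderiv ℝ ψ x (1, 0, 0) :=
  (h.hasFDerivAt.comp_hasDerivAt (f := fun t => (t, x.2.1, x.2.2)) x.1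
    ((hasDerivAt_id x.1).prodMk
      ((hasDerivAt_const x.1 x.2.1).prodMk (hasDerivAt_const x.1 x.2.2)))).deriv

lemma pd2_eq_fderiv {ψ : ℝ × ℝ × ℝ → ℂ} {x : ℝ × ℝ × ℝ} (h : DifferentiableAt ℝ ψ x) :
    pd2 ψ x = fderiv ℝ ψ x (0, 1, 0) :=
  (h.hasFDerivAt.comp_hasDerivAt (f := fun t => (x.1, t, x.2.2)) x.2.1
    ((hasDerivAt_const x.2.1 x.1).prodMk
      ((hasDerivAt_id x.2.1).prodMk (hasDerivAt_const x.2.1 x.2.2)))).deriv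

lemma pd3_eq_fderiv {ψ : ℝ × ℝ × ℝ → ℂ} {x : ℝ × ℝ × ℝ} (h : DifferentiableAt ℝ ψ x) :
    pd3 ψ x = fderiv ℝ ψ x (0, 0, 1) :=
  (h.hasFDerivAt.comp_hasDerivAt (f := fun t => (x.1, x.2.1, t)) x.2.2
    ((hasDerivAt_const x.2.2 x.1).prodMk
      ((hasDerivAt_const x.2.2 x.2.1).prodMk (hasDerivAt_id x.2.2)))).deriv

namespace IsTest3

variable {ω : Set (ℝ × ℝ)} {ψ : ℝ × ℝ × ℝ → ℂ}

lemma differentiable (hψ : IsTest3 (Omega0 ω) ψ) : Differentiable ℝ ψ :=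
  hψ.1.differentiable (by simp)

lemma continuous_fderiv (hψ : IsTest3 (Omega0 ω) ψ) : Continuous (fderiv ℝ ψ) :=
  hψ.1.continuous_fderiv (by simp)

lemma pd1_eq (hψ : IsTest3 (Omega0 ω) ψ) : pd1 ψ = fun x => fderiv ℝ ψ x (1, 0, 0) :=
  funext fun x => pd1_eq_fderiv (hψ.differentiable x)

lemma pd2_eq (hψ : IsTest3 (Omega0 ω) ψ) : pd2 ψ = fun x => fderiv ℝ ψ x (0, 1, 0) :=
  funext fun x => pd2_eq_fderiv (hψ.differentiable x)

lemma pd3_eq (hψ : IsTest3 (Omega0 ω) ψ) : pd3 ψ = fun x => fderiv ℝ ψ x (0, 0, 1) :=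
  funext fun x => pd3_eq_fderiv (hψ.differentiable x)

lemma continuous_pd2 (hψ : IsTest3 (Omega0 ω) ψ) : Continuous (pd2 ψ) := by
  have := hψ.continuous_fderiv
  rw [hψ.pd2_eq]
  fun_prop

lemma continuous_pd3 (hψ : IsTest3 (Omega0 ω) ψ) : Continuous (pd3 ψ) := by
  have := hψ.continuous_fderiv
  rw [hψ.pd3_eq]
  fun_prop

lemma continuous_twistedDeriv (hψ : IsTest3 (Omega0 ω) ψ) {θ : ℝ → ℝ} (hθ : ContDiff ℝ 1 θ) :
    Continuous (twistedDeriv θ ψ) := by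
  have h := hψ.continuous_fderiv
  have h2 := hψ.continuous_pd2
  have h3 := hψ.continuous_pd3
  have h4 : Continuous (deriv θ) := hθ.continuous_deriv le_rfl
  have h1 : Continuous (pd1 ψ) := by
    rw [hψ.pd1_eq]
    fun_prop
  unfold twistedDeriv pdtau
  fun_prop

lemma support_pd2_subset (hψ : IsTest3 (Omega0 ω) ψ) : Function.support (pd2 ψ) ⊆ tsupport ψ := by
  intro x hx
  refine support_fderiv_subset ℝ fun h => hx ?_
  simp [hψ.pd2_eq, h]

lemma support_pd3_subset (hψ : IsTest3 (Omega0 ω) ψ) : Function.support (pd3 ψ) ⊆ tsupport ψ := by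
  intro x hx
  refine support_fderiv_subset ℝ fun h => hx ?_
  simp [hψ.pd3_eq, h]

lemma support_twistedDeriv_subset (hψ : IsTest3 (Omega0 ω) ψ) (θ : ℝ → ℝ) :
    Function.support (twistedDeriv θ ψ) ⊆ tsupport ψ := by
  intro x hx
  refine support_fderiv_subset ℝ fun h => hx ?_
  simp [twistedDeriv, pdtau, hψ.pd1_eq, hψ.pd2_eq, hψ.pd3_eq, h]

lemma hasCompactSupport (hψ : IsTest3 (Omega0 ω) ψ) {f : ℝ × ℝ × ℝ → ℂ}
    (hf : Function.support f ⊆ tsupport ψ) : HasCompactSupport f :=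
  hψ.2.1.mono' hf

lemma slice (hψ : IsTest3 (Omega0 ω) ψ) (s : ℝ) : IsTest2 ω fun y => ψ (s, y) :=
  ⟨hψ.1.comp (contDiff_const.prodMk contDiff_id), hψ.2.1.slice_left s,
    fun _ hy => hψ.2.2 (tsupport_comp_subset_preimage ψ (f := fun y => (s, y)) (by fun_prop) hy)⟩

lemma hasDerivAt_twist (hψ : IsTest3 (Omega0 ω) ψ) {θ : ℝ → ℝ} (hθ : ContDiff ℝ 1 θ) (b : ℝ)
    (y : ℝ × ℝ) (s : ℝ) :
    HasDerivAt (fun s => ψ (s, rot (b - θ s) y)) (twistedDeriv θ ψ (s, rot (b - θ s) y)) s := by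
  have h1 : HasDerivAt (fun s => b - θ s) (-deriv θ s) s :=
    ((hθ.differentiable one_ne_zero) s).hasDerivAt.const_sub b
  have h2 := (hasDerivAt_rot (b - θ s) y).scomp s h1
  have h3 := (hψ.differentiable (s, rot (b - θ s) y)).hasFDerivAt.comp_hasDerivAt
    (f := fun s => (s, rot (b - θ s) y)) s ((hasDerivAt_id s).prodMk h2)
  refine h3.congr_deriv ?_
  simp only [twistedDeriv, pdtau, hψ.pd1_eq, hψ.pd2_eq, hψ.pd3_eq]
  set q := rot (b - θ s) y
  set L := fderiv ℝ ψ (s, q)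
  rw [← map_smul, ← map_smul, ← map_sub, ← map_smul, ← map_sub]
  congr 1
  ext <;> simp

lemma setIntegral_eq {f : ℝ × ℝ × ℝ → ℝ} (hψ : IsTest3 (Omega0 ω) ψ)
    (hf : Function.support f ⊆ tsupport ψ) : ∫ x in Omega0 ω, f x = ∫ x, f x := by
  refine setIntegral_eq_integral_of_forall_compl_eq_zero fun x hx => ?_
  by_contra h
  exact hx (hψ.2.2 (hf h))

end IsTest3

/-- The weighted Hardy inequality for the twisted form, given that a gap inequality holds on the
part of `ω` which the twist rotates out of `ω`. -/
lemma IsTest3.integral_weight_le {ω : Set (ℝ × ℝ)} (hω : IsOpen ω) {θ : ℝ → ℝ}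
    (hθ : ContDiff ℝ 1 θ) {a t c : ℝ} (ha : ∀ s ≤ a, θ s = θ a) (hc0 : 0 ≤ c)
    (hc : ∀ f, IsTest2 ω f → c * ∫ p, ‖f p‖ ^ 2 ≤ (∫ p, normGradSq f p)
      - E1 ω * (∫ p, ‖f p‖ ^ 2) + ∫ p in ω \ rot (θ a - θ t) ⁻¹' ω, ‖f p‖ ^ 2)
    {ψ : ℝ × ℝ × ℝ → ℂ} (hψ : IsTest3 (Omega0 ω) ψ) :
    c * ∫ x, ‖ψ x‖ ^ 2 / (2 + |x.1 - a|) ^ 2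
      ≤ 4 * (2 + |a - t| + c) * (Qform θ ω ψ - E1 ω * ∫ x in Omega0 ω, ‖ψ x‖ ^ 2) := by
  have hγ : Continuous fun s => θ a - θ s := by
    have := hθ.continuous
    fun_prop
  set Ψ : ℝ × ℝ × ℝ → ℂ := ψ ∘ twist _ hγ with hΨ
  set Ψ' : ℝ × ℝ × ℝ → ℂ := twistedDeriv θ ψ ∘ twist _ hγ with hΨ'
  have hψc : Continuous ψ := hψ.1.continuous
  have hTc := hψ.continuous_twistedDeriv hθ
  have hTs := hψ.hasCompactSupport (hψ.support_twistedDeriv_subset θ)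
  have hΨc : Continuous Ψ := hψc.comp (twist _ hγ).continuous
  have hΨ'c : Continuous Ψ' := hTc.comp (twist _ hγ).continuous
  have hΨs : HasCompactSupport Ψ := hψ.2.1.comp_homeomorph _
  have hΨ's : HasCompactSupport Ψ' := hTs.comp_homeomorph _
  have hder : ∀ y s, HasDerivAt (fun s => Ψ (s, y)) (Ψ' (s, y)) s := fun y s =>
    hψ.hasDerivAt_twist hθ (θ a) y s
  have hder_cont : ∀ y, Continuous fun s => Ψ' (s, y) := fun y => by fun_prop
  have hiΨ' : Integrable (fun x => ‖Ψ' x‖ ^ 2) (volume.prod volume) :=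
    integrable_norm_sq hΨ'c hΨ's
  have hiT : Integrable fun x => ‖twistedDeriv θ ψ x‖ ^ 2 := integrable_norm_sq hTc hTs
  have hi2 : Integrable fun x => ‖pd2 ψ x‖ ^ 2 :=
    integrable_norm_sq hψ.continuous_pd2 (hψ.hasCompactSupport hψ.support_pd2_subset)
  have hi3 : Integrable fun x => ‖pd3 ψ x‖ ^ 2 :=
    integrable_norm_sq hψ.continuous_pd3 (hψ.hasCompactSupport hψ.support_pd3_subset)
  have hiψ : Integrable fun x => ‖ψ x‖ ^ 2 := integrable_norm_sq hψc hψ.2.1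
  set τ := ∫ x, ‖twistedDeriv θ ψ x‖ ^ 2 with hτ
  have hτ0 : 0 ≤ τ := integral_nonneg fun x => by positivity
  have hτy : ∫ y, ∫ s, ‖Ψ' (s, y)‖ ^ 2 = τ := by
    rw [← integral_prod_symm _ hiΨ', ← Measure.volume_eq_prod]
    exact integral_comp_twist _ hγ fun x => ‖twistedDeriv θ ψ x‖ ^ 2
  -- the transverse excess energy of the slices
  set k : ℝ → ℝ := fun s => (∫ y, normGradSq (fun y => ψ (s, y)) y)
    - E1 ω * ∫ y, ‖ψ (s, y)‖ ^ 2 with hk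
  have hk0 : ∀ s, 0 ≤ k s := fun s => sub_nonneg.2 (hψ.slice s).E1_mul_le
  have hi23 : Integrable (fun x => ‖pd2 ψ x‖ ^ 2 + ‖pd3 ψ x‖ ^ 2)
      ((volume : Measure ℝ).prod (volume : Measure (ℝ × ℝ))) := hi2.fun_add hi3
  have hiψ' : Integrable (fun x => ‖ψ x‖ ^ 2)
      ((volume : Measure ℝ).prod (volume : Measure (ℝ × ℝ))) := hiψ
  have hki : Integrable k := hi23.integral_prod_left.sub (hiψ'.integral_prod_left.const_mul _)
  have hkint : (∫ s, k s) + τ = Qform θ ω ψ - E1 ω * ∫ x in Omega0 ω, ‖ψ x‖ ^ 2 := by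
    have hkk : ∫ s, k s = (∫ x, (‖pd2 ψ x‖ ^ 2 + ‖pd3 ψ x‖ ^ 2)) - E1 ω * ∫ x, ‖ψ x‖ ^ 2 := by
      refine (integral_sub hi23.integral_prod_left
        (hiψ'.integral_prod_left.const_mul (E1 ω))).trans ?_
      rw [integral_const_mul, Measure.volume_eq_prod ℝ (ℝ × ℝ), integral_prod _ hi23,
        integral_prod _ hiψ']
    have hQ : Qform θ ω ψ
        = ∫ x, (‖twistedDeriv θ ψ x‖ ^ 2 + (‖pd2 ψ x‖ ^ 2 + ‖pd3 ψ x‖ ^ 2)) := by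
      simp only [← add_assoc]
      refine hψ.setIntegral_eq fun x hx => ?_
      by_contra h
      have h1 := fun h' => h (hψ.support_twistedDeriv_subset θ h')
      have h2 := fun h' => h (hψ.support_pd2_subset h')
      have h3 := fun h' => h (hψ.support_pd3_subset h')
      simp only [Function.mem_support, ne_eq, not_not, imp_false] at h1 h2 h3
      refine hx ?_
      change ‖twistedDeriv θ ψ x‖ ^ 2 + ‖pd2 ψ x‖ ^ 2 + ‖pd3 ψ x‖ ^ 2 = 0
      simp [h1, h2, h3]
    have hN : ∫ x in Omega0 ω, ‖ψ x‖ ^ 2 = ∫ x, ‖ψ x‖ ^ 2 :=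
      hψ.setIntegral_eq fun x hx => subset_tsupport ψ fun h => hx (by simp [h])
    rw [hkk, hQ, hN, integral_add hiT (hi2.fun_add hi3)]
    ring
  have hmain : ∀ s ∈ Icc (a - 1) a, c * ∫ x, ‖ψ x‖ ^ 2 / (2 + |x.1 - a|) ^ 2
      ≤ 4 * k s + 4 * (1 + |a - t| + c) * τ := by
    intro s hs
    have hflat : ∀ y, Ψ (s, y) = ψ (s, y) := fun y => by
      show ψ (s, rot (θ a - θ s) y) = _
      rw [ha s hs.2, sub_self, rot_zero]
    have hsl : Integrable fun y => ‖Ψ (s, y)‖ ^ 2 :=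
      integrable_norm_sq (by fun_prop) (hΨs.slice_left s)
    have hhardy : ∫ x, ‖ψ x‖ ^ 2 / (2 + |x.1 - a|) ^ 2 ≤ 4 * (∫ y, ‖ψ (s, y)‖ ^ 2) + 4 * τ := by
      have hw0 : ∀ x : ℝ × ℝ × ℝ, (2 + |x.1 - a|) ^ 2 ≠ 0 := fun x => by positivity
      have hiW : Integrable (fun x => ‖Ψ x‖ ^ 2 / (2 + |x.1 - a|) ^ 2)
          ((volume : Measure ℝ).prod (volume : Measure (ℝ × ℝ))) :=
        integrable_norm_sq_div hΨc hΨs (by fun_prop) hw0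
      have h1 : ∫ x, ‖ψ x‖ ^ 2 / (2 + |x.1 - a|) ^ 2
          = ∫ y, ∫ r, ‖Ψ (r, y)‖ ^ 2 / (2 + |r - a|) ^ 2 := by
        rw [← integral_comp_twist _ hγ, ← integral_prod_symm _ hiW]
        rfl
      have h2 : ∀ y, ∫ r, ‖Ψ (r, y)‖ ^ 2 / (2 + |r - a|) ^ 2
          ≤ 4 * ‖Ψ (s, y)‖ ^ 2 + 4 * ∫ r, ‖Ψ' (r, y)‖ ^ 2 := by
        intro y
        have hsup := hΨs.slice_right y
        refine le_trans (integral_mono ?_ ?_ fun r => ?_)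
          (integral_hardy (hder y) (hder_cont y) hsup s)
        · exact integrable_norm_sq_div (by fun_prop) hsup (by fun_prop) fun r => by positivity
        · exact integrable_norm_sq_div (by fun_prop) hsup (by fun_prop) fun r => by positivity
        · have h3 : |r - s| ≤ |r - a| + 1 := by
            have := abs_sub_le r a s
            have h4 : |a - s| ≤ 1 := by
              rw [abs_of_nonneg (sub_nonneg.2 hs.2)]
              linarith [hs.1]
            linarith
          have h4 : 1 + |r - s| ≤ 2 + |r - a| := by linarith
          show ‖Ψ (r, y)‖ ^ 2 / (2 + |r - a|) ^ 2 ≤ ‖Ψ (r, y)‖ ^ 2 / (1 + |r - s|) ^ 2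
          gcongr
      rw [h1]
      refine (integral_mono hiW.integral_prod_right
        ((hsl.const_mul 4).fun_add (hiΨ'.integral_prod_right.const_mul 4)) h2).trans_eq ?_
      rw [integral_add (hsl.const_mul 4) (hiΨ'.integral_prod_right.const_mul 4),
        integral_const_mul, integral_const_mul, hτy]
      simp only [hflat]
    have hA : ∫ y in ω \ rot (θ a - θ t) ⁻¹' ω, ‖ψ (s, y)‖ ^ 2 ≤ (1 + |a - t|) * τ := by
      have hAm : MeasurableSet (ω \ rot (θ a - θ t) ⁻¹' ω) :=
        hω.measurableSet.diff ((measurePreserving_rot _).measurable hω.measurableSet)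
      have h1 : ∀ y ∈ ω \ rot (θ a - θ t) ⁻¹' ω,
          ‖Ψ (s, y)‖ ^ 2 ≤ |s - t| * ∫ r, ‖Ψ' (r, y)‖ ^ 2 := by
        intro y hy
        have h0 : Ψ (t, y) = 0 :=
          image_eq_zero_of_notMem_tsupport (f := ψ) (x := (t, rot (θ a - θ t) y))
            fun h => hy.2 (hψ.2.2 h)
        have := norm_sub_sq_le (hder y) (hder_cont y) (hΨs.slice_right y) s t
        rwa [h0, sub_zero] at this
      have hiI := hiΨ'.integral_prod_right
      have h2 := setIntegral_mono_on hsl.integrableOn (hiI.const_mul |s - t|).integrableOn hAm h1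
      rw [integral_const_mul] at h2
      have h3 : ∫ y in ω \ rot (θ a - θ t) ⁻¹' ω, ∫ r, ‖Ψ' (r, y)‖ ^ 2 ≤ τ := by
        rw [← hτy]
        exact setIntegral_le_integral hiI
          (ae_of_all _ fun y => integral_nonneg fun r => by positivity)
      have h4 : |s - t| ≤ 1 + |a - t| := by
        have := abs_sub_le s a t
        have h5 : |s - a| ≤ 1 := by
          rw [abs_of_nonpos (sub_nonpos.2 hs.2)]
          linarith [hs.1]
        linarith
      simp only [hflat] at h2
      calc _ ≤ _ := h2
        _ ≤ |s - t| * τ := by gcongr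
        _ ≤ _ := by gcongr
    have h := hc _ (hψ.slice s)
    have h2 := mul_le_mul_of_nonneg_left hhardy hc0
    simp only [hk]
    linarith
  have hav := setIntegral_mono_on (s := Icc (a - 1) a) (μ := volume)
    (integrableOn_const (by simp)) ((hki.const_mul 4).integrableOn.fun_add
      (integrableOn_const (by simp))) measurableSet_Icc hmain
  rw [integral_add (hki.const_mul 4).integrableOn (integrableOn_const (by simp)),
    integral_const_mul 4] at hav
  simp only [setIntegral_const, smul_eq_mul, Real.volume_real_Icc] at hav
  have hkJ : ∫ s in Icc (a - 1) a, k s ≤ ∫ s, k s :=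
    setIntegral_le_integral hki (ae_of_all _ hk0)
  have hmax : max (a - (a - 1)) 0 = 1 := by
    rw [sub_sub_cancel]
    exact max_eq_left zero_le_one
  rw [hmax, one_mul, one_mul] at hav
  have hK0 : 0 ≤ ∫ s, k s := integral_nonneg hk0
  rw [← hkint]
  have : 0 ≤ (1 + |a - t| + c) * ∫ s, k s := by positivity
  nlinarith

lemma exists_forall_le_eq_of_hasCompactSupport_deriv {θ : ℝ → ℝ} (hθ : Differentiable ℝ θ)
    (hsupp : HasCompactSupport (deriv θ)) : ∃ a, ∀ s ≤ a, θ s = θ a := by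
  obtain ⟨r, hr⟩ := hsupp.isCompact.isBounded.subset_ball 0
  refine ⟨-r, fun s hs => ?_⟩
  refine (convex_Iic (-r)).is_const_of_fderivWithin_eq_zero (𝕜 := ℝ) hθ.differentiableOn
    (fun x hx => ?_) hs self_mem_Iic
  have h0 : deriv θ x = 0 := by
    refine image_eq_zero_of_notMem_tsupport fun h => ?_
    have h1 := hr h
    rw [Real.ball_eq_Ioo] at h1
    have h2 : x ≤ -r := hx
    linarith [h1.1]
  rw [(hθ x).fderivWithin (uniqueDiffOn_Iic (-r) x hx)]
  ext
  simpa using h0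

lemma exists_le_div_sq {ω : Set (ℝ × ℝ)} {v : ℝ × ℝ × ℝ → ℝ} (hv : ∃ M : ℝ, ∀ x, v x ≤ M)
    {c R : ℝ} (hc : 0 < c) (hR : 0 < R)
    (h : ∀ x : ℝ × ℝ × ℝ, x ∈ Omega0 ω → R ≤ |x.1| → v x ≤ c / x.1 ^ 2) (a : ℝ) :
    ∃ C, 0 < C ∧ ∀ x ∈ Omega0 ω, v x ≤ C / (2 + |x.1 - a|) ^ 2 := by
  obtain ⟨M, hM⟩ := hv
  set L := 2 + |a| + R with hL
  have hL0 : 0 < L := by positivity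
  refine ⟨|M| * L ^ 2 + c * (L / R) ^ 2, by positivity, fun x hx => ?_⟩
  have hb := abs_sub x.1 a
  rw [le_div_iff₀ (by positivity)]
  rcases le_or_gt R |x.1| with hx1 | hx1
  · have h0 : 0 < |x.1| := hR.trans_le hx1
    have h1 : 2 + |x.1 - a| ≤ L / R * |x.1| := by
      rw [div_mul_eq_mul_div, le_div_iff₀ hR, hL]
      nlinarith [abs_nonneg a]
    calc v x * (2 + |x.1 - a|) ^ 2 ≤ c / x.1 ^ 2 * (2 + |x.1 - a|) ^ 2 := by
          gcongr
          exact h x hx hx1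
      _ ≤ c / x.1 ^ 2 * (L / R * |x.1|) ^ 2 := by gcongr
      _ = c * (L / R) ^ 2 := by
        have : x.1 ≠ 0 := abs_pos.1 h0
        rw [mul_pow, sq_abs]
        field_simp
      _ ≤ _ := le_add_of_nonneg_left (by positivity)
  · have h1 : 2 + |x.1 - a| ≤ L := by linarith
    calc v x * (2 + |x.1 - a|) ^ 2 ≤ |M| * (2 + |x.1 - a|) ^ 2 := by
          gcongr
          exact (hM x).trans (le_abs_self M)
      _ ≤ |M| * L ^ 2 := by gcongr
      _ ≤ _ := le_add_of_nonneg_right (by positivity)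

/-- spectral stability in a twisted tube. For a bounded nonnegative
potential v ∼ |x₁|⁻² at infinity, not a.e. zero, there is ε₀ > 0 such that for all
ε ∈ (0,ε₀) the perturbed form satisfies Q_θ[ψ] − ε∫v|ψ|² ≥ E₁∫|ψ|², i.e. the spectrum
of −Δ_D^{Ω_θ} − εV does not drop below E₁. -/
theorem spectral_stability_twisted
    (ω : Set (ℝ × ℝ)) (hω_open : IsOpen ω) (hω_bdd : Bornology.IsBounded ω)
    (hω_conn : IsConnected ω)
    (θ : ℝ → ℝ) (hθ : ContDiff ℝ 1 θ) (hθ' : ∃ M : ℝ, ∀ t : ℝ, |deriv θ t| ≤ M)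
    (hsupp : HasCompactSupport (deriv θ))
    (htw : Twisted θ ω)
    (v : ℝ × ℝ × ℝ → ℝ) (hv_meas : Measurable v)
    (hv_nonneg : ∀ x, 0 ≤ v x) (hv_bdd : ∃ M : ℝ, ∀ x, v x ≤ M)
    (hv_ne : ¬ (v =ᵐ[volume.restrict (Omega0 ω)] 0))
    (hv_asymp : ∃ c₁ c₂ R : ℝ, 0 < c₁ ∧ 0 < c₂ ∧ 0 < R ∧
      ∀ x : ℝ × ℝ × ℝ, x ∈ Omega0 ω → R ≤ |x.1| →
        c₁ / x.1 ^ 2 ≤ v x ∧ v x ≤ c₂ / x.1 ^ 2) :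
    ∃ ε₀ : ℝ, 0 < ε₀ ∧ ∀ ε : ℝ, 0 < ε → ε < ε₀ →
      ∀ ψ : ℝ × ℝ × ℝ → ℂ, IsTest3 (Omega0 ω) ψ →
        E1 ω * ∫ x in Omega0 ω, ‖ψ x‖ ^ 2
          ≤ Qform θ ω ψ - ε * ∫ x in Omega0 ω, v x * ‖ψ x‖ ^ 2 := by
  obtain ⟨a, ha⟩ := exists_forall_le_eq_of_hasCompactSupport_deriv
    (hθ.differentiable one_ne_zero) hsupp
  obtain ⟨⟨s₁, s₂, hs⟩, ϑ, -, hϑ⟩ := htw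
  obtain ⟨b, hb⟩ : ∃ b, θ a - θ b ≠ 0 := by
    by_contra! h
    exact hs (by linarith [h s₁, h s₂])
  obtain ⟨t, ht⟩ := exists_measure_sdiff_rot_ne_zero hω_open hω_bdd (γ := fun s => θ a - θ s)
    (continuous_const.sub hθ.continuous) (sub_self _) hb hϑ
  obtain ⟨c, hc0, hc⟩ := exists_gap hω_open hω_bdd hω_conn.isPreconnected
    (hω_open.measurableSet.diff ((measurePreserving_rot _).measurable hω_open.measurableSet))
    sdiff_subset ht
  obtain ⟨c₁, c₂, R, -, hc₂, hR, hv⟩ := hv_asymp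
  obtain ⟨C, hC0, hC⟩ := exists_le_div_sq hv_bdd hc₂ hR (fun x hx hxR => (hv x hx hxR).2) a
  set D := 4 * (2 + |a - t| + c) with hD
  have hD0 : 0 < D := by positivity
  refine ⟨c / (C * D), by positivity, fun ε hε hε' ψ hψ => ?_⟩
  have hmain := hψ.integral_weight_le hω_open hθ ha hc0.le hc
  have hw0 : ∀ x : ℝ × ℝ × ℝ, (2 + |x.1 - a|) ^ 2 ≠ 0 := fun x => by positivity
  have hiW : Integrable fun x => ‖ψ x‖ ^ 2 / (2 + |x.1 - a|) ^ 2 :=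
    integrable_norm_sq_div hψ.1.continuous hψ.2.1 (by fun_prop) hw0
  set W := ∫ x, ‖ψ x‖ ^ 2 / (2 + |x.1 - a|) ^ 2 with hW
  have hvW : ∫ x in Omega0 ω, v x * ‖ψ x‖ ^ 2 ≤ C * W := by
    rw [hW, ← hψ.setIntegral_eq (f := fun x => ‖ψ x‖ ^ 2 / (2 + |x.1 - a|) ^ 2)
      (fun x hx => subset_tsupport ψ fun h => hx (by simp [h])), ← integral_const_mul]
    refine integral_mono_of_nonneg (ae_of_all _ fun x => mul_nonneg (hv_nonneg x) (by positivity))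
      (hiW.const_mul C).integrableOn ?_
    refine (ae_restrict_mem (hω_open.preimage continuous_snd).measurableSet).mono fun x hx => ?_
    have := mul_le_mul_of_nonneg_right (hC x hx) (sq_nonneg ‖ψ x‖)
    show v x * ‖ψ x‖ ^ 2 ≤ C * (‖ψ x‖ ^ 2 / (2 + |x.1 - a|) ^ 2)
    rwa [div_mul_eq_mul_div, mul_div_assoc] at this
  have hW0 : 0 ≤ W := integral_nonneg fun x => by positivity
  have hεv : ε * ∫ x in Omega0 ω, v x * ‖ψ x‖ ^ 2
      ≤ Qform θ ω ψ - E1 ω * ∫ x in Omega0 ω, ‖ψ x‖ ^ 2 := by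
    calc ε * ∫ x in Omega0 ω, v x * ‖ψ x‖ ^ 2 ≤ ε * (C * W) := by gcongr
      _ ≤ c / (C * D) * (C * W) := by gcongr
      _ = c * W / D := by field_simp
      _ ≤ _ := by
        rw [div_le_iff₀ hD0]
        linarith
  linarith
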